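/- Let R = k[x_1,…,x_n] be a standard graded polynomial ring over an infinite field, let i be a positive integer, and let M be a finitely generated graded R-module with depth(M) > 0 and depth(Ext^{n-ℓ}_R(M,R)) > 0 for all ℓ ≥ i−1. Then, for a sufficiently general homogeneous element x ∈ R, if M/xM is (i−1)-partially sequentially Cohen-Macaulay, then M is i-partially sequentially Cohen-Macaulay. -/

import Mathlib

open CategoryTheory

noncomputable section

/-- The (Krull) dimension of a module: the Krull dimension of its support.
The dimension of the zero module is `⊥` (thought of as `-1`). -/
noncomputable def mDim (R : Type) [CommRing R] (M : Type) [AddCommGroup M] [Module R M] :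
    WithBot ℕ∞ :=
  Order.krullDim (Module.support R M)

/-- The `i`-th Ext module `Ext_R^i(A, B)` (as a type). -/
noncomputable abbrev extC (R : Type) [CommRing R] (i : ℕ) (A B : Type)
    [AddCommGroup A] [Module R A] [AddCommGroup B] [Module R B] : Type :=
  ↥(((Ext R (ModuleCat R) i).obj (Opposite.op (ModuleCat.of R A))).obj (ModuleCat.of R B))

/-- The depth of a module `M` with respect to an ideal `I`:
the least `i` such that `Ext_R^i(R/I, M) ≠ 0` (and `⊤` if there is no such `i`,
in particular the depth of the zero module is `⊤ = +∞`). -/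
noncomputable def mDepth (R : Type) [CommRing R] (I : Ideal R) (M : Type)
    [AddCommGroup M] [Module R M] : ℕ∞ :=
  sInf {i : ℕ∞ | ∃ j : ℕ, i = j ∧ Nontrivial (extC R j (R ⧸ I) M)}

/-- `M` is a Cohen-Macaulay module (with respect to the (maximal) ideal `I`) if it is
nonzero and its depth equals its dimension. -/
def IsCM (R : Type) [CommRing R] (I : Ideal R) (M : Type) [AddCommGroup M] [Module R M] :
    Prop :=
  Nontrivial M ∧ (mDepth R I M : WithBot ℕ∞) = mDim R M

/-- The subquotient `N'/N` of a module (most meaningful when `N ≤ N'`). -/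
abbrev subQuot (R : Type) [CommRing R] {M : Type} [AddCommGroup M] [Module R M]
    (N N' : Submodule R M) : Type :=
  N' ⧸ (Submodule.comap N'.subtype N)

/-- `F 0 = 0 ⊊ F 1 ⊊ ⋯ ⊊ F r = M` is a sCM filtration: each quotient `F (i+1) / F i`
is Cohen-Macaulay and the dimensions of the quotients are strictly increasing. -/
def IsSCMFil (R : Type) [CommRing R] (I : Ideal R) {M : Type} [AddCommGroup M] [Module R M]
    (r : ℕ) (F : ℕ → Submodule R M) : Prop :=
  F 0 = ⊥ ∧ F r = ⊤ ∧ (∀ i < r, F i < F (i + 1)) ∧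
    (∀ i < r, IsCM R I (subQuot R (F i) (F (i + 1)))) ∧
    (∀ i, i + 1 < r →
      mDim R (subQuot R (F i) (F (i + 1))) < mDim R (subQuot R (F (i + 1)) (F (i + 2))))

/-- `M` is sequentially Cohen-Macaulay if it admits a sCM filtration. -/
def IsSeqCM (R : Type) [CommRing R] (I : Ideal R) (M : Type) [AddCommGroup M] [Module R M] :
    Prop :=
  ∃ (r : ℕ) (F : ℕ → Submodule R M), IsSCMFil R I r F

/-- `δ_c(M)`: the largest submodule of `M` of dimension at most `c`. -/
noncomputable def deltaSub (R : Type) [CommRing R] (M : Type) [AddCommGroup M] [Module R M]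
    (c : ℕ) : Submodule R M :=
  sSup {N : Submodule R M | mDim R ↥N ≤ (c : WithBot ℕ∞)}

/-- `δ_{c-1}(M)`, with `δ_{-1}(M) = 0`. -/
noncomputable def deltaSubPred (R : Type) [CommRing R] (M : Type) [AddCommGroup M] [Module R M] :
    ℕ → Submodule R M
  | 0 => ⊥
  | (c + 1) => deltaSub R M c

/-- `H^0_I(M)`, the `I`-power-torsion submodule of `M`. -/
noncomputable def tors (R : Type) [CommRing R] (I : Ideal R) (M : Type) [AddCommGroup M]
    [Module R M] : Submodule R M :=
  ⨆ t : ℕ, Submodule.torsionBySet R M ((I ^ t : Ideal R) : Set R)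

end
noncomputable section

/-- The homogeneous maximal (irrelevant) ideal `𝔪 = (x_1, …, x_n)` of `k[x_1, …, x_n]`. -/
noncomputable def irrIdeal (k : Type) [Field k] (n : ℕ) : Ideal (MvPolynomial (Fin n) k) :=
  Ideal.span (Set.range MvPolynomial.X)

/-- The linear form with coefficients `a : Fin n → k`. -/
noncomputable def linForm (k : Type) [Field k] (n : ℕ) (a : Fin n → k) :
    MvPolynomial (Fin n) k :=
  ∑ i : Fin n, MvPolynomial.C (a i) * MvPolynomial.X i

/-- Given a ℤ-graded module `M` over `k[x_1, …, x_n]` with grading `𝒜`, a submodule `N` is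
graded (homogeneous) if it is spanned by its homogeneous elements. -/
def IsGradedSub (k : Type) [Field k] (n : ℕ) (M : Type) [AddCommGroup M]
    [Module (MvPolynomial (Fin n) k) M] [Module k M]
    [IsScalarTower k (MvPolynomial (Fin n) k) M]
    (𝒜 : ℤ → Submodule k M) (N : Submodule (MvPolynomial (Fin n) k) M) : Prop :=
  N.restrictScalars k ≤ ⨆ e : ℤ, (N.restrictScalars k ⊓ 𝒜 e)

/-- `δ_c(M/N)`: the largest graded submodule of `M/N` of dimension at most `c`, encoded as a
submodule of `M` containing `N`. -/
noncomputable def deltaPairG (k : Type) [Field k] (n : ℕ) (M : Type) [AddCommGroup M]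
    [Module (MvPolynomial (Fin n) k) M] [Module k M]
    [IsScalarTower k (MvPolynomial (Fin n) k) M]
    (𝒜 : ℤ → Submodule k M) (N : Submodule (MvPolynomial (Fin n) k) M) (c : ℕ) :
    Submodule (MvPolynomial (Fin n) k) M :=
  sSup {P | N ≤ P ∧ IsGradedSub k n M 𝒜 P ∧
    mDim (MvPolynomial (Fin n) k) (subQuot (MvPolynomial (Fin n) k) N P) ≤ (c : WithBot ℕ∞)}

/-- `δ_{c-1}(M/N)`, with the convention `δ_{-1} = 0` (i.e. `N` as a submodule of `M`). -/
noncomputable def deltaPairGPred (k : Type) [Field k] (n : ℕ) (M : Type) [AddCommGroup M]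
    [Module (MvPolynomial (Fin n) k) M] [Module k M]
    [IsScalarTower k (MvPolynomial (Fin n) k) M]
    (𝒜 : ℤ → Submodule k M) (N : Submodule (MvPolynomial (Fin n) k) M) :
    ℕ → Submodule (MvPolynomial (Fin n) k) M
  | 0 => N
  | (c + 1) => deltaPairG k n M 𝒜 N c

/-- The quotient `M/N` (of the graded module `M` by a graded submodule `N`) is
`i`-partially sequentially Cohen-Macaulay: the quotients `δ_j/δ_{j-1}` of its dimension
filtration (by largest graded submodules of dimension `≤ j`) are zero or Cohen-Macaulay
for all `j ≥ i`. -/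
noncomputable def IsPartiallySCM (k : Type) [Field k] (n : ℕ) (M : Type) [AddCommGroup M]
    [Module (MvPolynomial (Fin n) k) M] [Module k M]
    [IsScalarTower k (MvPolynomial (Fin n) k) M]
    (𝒜 : ℤ → Submodule k M) (N : Submodule (MvPolynomial (Fin n) k) M) (i : ℕ) : Prop :=
  ∀ j : ℕ, i ≤ j →
    Subsingleton (subQuot (MvPolynomial (Fin n) k)
      (deltaPairGPred k n M 𝒜 N j) (deltaPairG k n M 𝒜 N j)) ∨
    IsCM (MvPolynomial (Fin n) k) (irrIdeal k n)
      (subQuot (MvPolynomial (Fin n) k)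
        (deltaPairGPred k n M 𝒜 N j) (deltaPairG k n M 𝒜 N j))

end
noncomputable section
/-- The `j`-th local cohomology module `H^j_𝔪(A)` of a module `A` over `k[x_1, …, x_n]`,
with support in the homogeneous maximal ideal `𝔪`, as a type. -/
noncomputable abbrev locCoh (k : Type) [Field k] (n : ℕ) (j : ℕ) (A : Type) [AddCommGroup A]
    [Module (MvPolynomial (Fin n) k) A] : Type :=
  ↥((localCohomology (irrIdeal k n) j).obj (ModuleCat.of (MvPolynomial (Fin n) k) A))
end

section ExtMachinery

variable {R : Type} [CommRing R]

/-- Ext of modules in the derived category sense. -/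
abbrev XX (R : Type) [CommRing R] (A B : Type) [AddCommGroup A] [Module R A]
    [AddCommGroup B] [Module R B] (a : ℕ) : Type :=
  Abelian.Ext.{0} (ModuleCat.of R A) (ModuleCat.of R B) a

variable {A B C W V : Type} [AddCommGroup A] [Module R A] [AddCommGroup B] [Module R B]
  [AddCommGroup C] [Module R C] [AddCommGroup W] [Module R W] [AddCommGroup V] [Module R V]

/-- Contravariant functoriality. -/
noncomputable def preX (f : A →ₗ[R] B) (W : Type) [AddCommGroup W] [Module R W] (a : ℕ) :
    XX R B W a →ₗ[R] XX R A W a :=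
  Abelian.Ext.precompOfLinear (Abelian.Ext.mk₀ (ModuleCat.ofHom f)) R (ModuleCat.of R W)
    (zero_add a)

/-- Covariant functoriality. -/
noncomputable def postX (V : Type) [AddCommGroup V] [Module R V] (f : A →ₗ[R] B) (a : ℕ) :
    XX R V A a →ₗ[R] XX R V B a :=
  Abelian.Ext.postcompOfLinear (Abelian.Ext.mk₀ (ModuleCat.ofHom f)) R (ModuleCat.of R V)
    (add_zero a)

lemma preX_apply (f : A →ₗ[R] B) (a : ℕ) (y : XX R B W a) :
    preX f W a y = (Abelian.Ext.mk₀ (ModuleCat.ofHom f)).comp y (zero_add a) := rfl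

lemma postX_apply (f : A →ₗ[R] B) (a : ℕ) (y : XX R V A a) :
    postX V f a y = y.comp (Abelian.Ext.mk₀ (ModuleCat.ofHom f)) (add_zero a) := rfl

lemma preX_comp (f : A →ₗ[R] B) (g : B →ₗ[R] C) (a : ℕ) (y : XX R C W a) :
    preX f W a (preX g W a y) = preX (g ∘ₗ f) W a y := by
  rw [preX_apply, preX_apply, preX_apply, Abelian.Ext.mk₀_comp_mk₀_assoc, ModuleCat.ofHom_comp]

lemma postX_comp (f : A →ₗ[R] B) (g : B →ₗ[R] C) (a : ℕ) (y : XX R V A a) :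
    postX V g a (postX V f a y) = postX V (g ∘ₗ f) a y := by
  rw [postX_apply, postX_apply, postX_apply, Abelian.Ext.comp_assoc_of_third_deg_zero,
    Abelian.Ext.mk₀_comp_mk₀, ModuleCat.ofHom_comp]

lemma preX_smul_id (x : R) (a : ℕ) (y : XX R A W a) :
    preX (x • LinearMap.id) W a y = x • y := by
  rw [preX_apply, show ModuleCat.ofHom (x • (LinearMap.id : A →ₗ[R] A)) =
    x • 𝟙 (ModuleCat.of R A) from rfl, Abelian.Ext.mk₀_smul, Abelian.Ext.smul_comp,
    Abelian.Ext.mk₀_id_comp]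

lemma postX_smul_id (x : R) (a : ℕ) (y : XX R V A a) :
    postX V (x • LinearMap.id) a y = x • y := by
  rw [postX_apply, show ModuleCat.ofHom (x • (LinearMap.id : A →ₗ[R] A)) =
    x • 𝟙 (ModuleCat.of R A) from rfl, Abelian.Ext.mk₀_smul, Abelian.Ext.comp_smul,
    Abelian.Ext.comp_mk₀_id]

lemma preX_id (a : ℕ) (y : XX R A W a) : preX LinearMap.id W a y = y := by
  have := preX_smul_id (A := A) (W := W) (1 : R) a y
  simpa using this

lemma postX_id (a : ℕ) (y : XX R V A a) : postX V LinearMap.id a y = y := by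
  have := postX_smul_id (A := A) (V := V) (1 : R) a y
  simpa using this

/-- The invariance of Ext in the first variable. -/
noncomputable def XXcongrLeft (e : A ≃ₗ[R] B) (W : Type) [AddCommGroup W] [Module R W] (a : ℕ) :
    XX R B W a ≃ₗ[R] XX R A W a :=
  LinearEquiv.ofLinearMap (preX e.toLinearMap W a) (preX e.symm.toLinearMap W a)
    (by ext y; simp [preX_comp, preX_id]) (by ext y; simp [preX_comp, preX_id])

/-- The invariance of Ext in the second variable. -/
noncomputable def XXcongrRight (V : Type) [AddCommGroup V] [Module R V] (e : A ≃ₗ[R] B) (a : ℕ) :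
    XX R V A a ≃ₗ[R] XX R V B a :=
  LinearEquiv.ofLinearMap (postX V e.toLinearMap a) (postX V e.symm.toLinearMap a)
    (by ext y; simp [postX_comp, postX_id]) (by ext y; simp [postX_comp, postX_id])

/-- A bundled short exact sequence. -/
structure SES (f : A →ₗ[R] B) (g : B →ₗ[R] C) : Prop where
  inj : Function.Injective f
  exact : Function.Exact f g
  surj : Function.Surjective g

lemma SES.shortExact {f : A →ₗ[R] B} {g : B →ₗ[R] C} (h : SES f g) :
    (ShortComplex.mk (ModuleCat.ofHom f) (ModuleCat.ofHom g)
      (by rw [← ModuleCat.ofHom_comp, h.exact.linearMap_comp_eq_zero]; rfl)).ShortExact := by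
  refine ShortComplex.ShortExact.mk' ?_ ?_ ?_
  · rw [ShortComplex.moduleCat_exact_iff]
    intro x hx
    exact (h.exact x).1 hx
  · exact (ModuleCat.mono_iff_injective _).2 h.inj
  · exact (ModuleCat.epi_iff_surjective _).2 h.surj

lemma les_pre {f : A →ₗ[R] B} {g : B →ₗ[R] C} (h : SES f g) (W : Type) [AddCommGroup W]
    [Module R W] (a : ℕ) : Function.Exact (preX g W a) (preX f W a) := by
  intro y
  constructor
  · intro hy
    exact Abelian.Ext.contravariant_sequence_exact₂ h.shortExact (ModuleCat.of R W) y hy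
  · rintro ⟨z, rfl⟩
    rw [preX_comp, h.exact.linearMap_comp_eq_zero]
    simp [preX_apply, ModuleCat.ofHom_zero]

lemma les_pre_delta {f : A →ₗ[R] B} {g : B →ₗ[R] C} (h : SES f g) (W : Type) [AddCommGroup W]
    [Module R W] (a : ℕ) : ∃ δ : XX R A W a →ₗ[R] XX R C W (a + 1),
      Function.Exact (preX f W a) δ ∧ Function.Exact δ (preX g W (a + 1)) := by
  refine ⟨Abelian.Ext.precompOfLinear h.shortExact.extClass R (ModuleCat.of R W)
    (add_comm 1 a), ?_, ?_⟩
  · intro y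
    constructor
    · intro hy
      exact Abelian.Ext.contravariant_sequence_exact₁ h.shortExact (ModuleCat.of R W) y (add_comm 1 a) hy
    · rintro ⟨z, rfl⟩
      exact h.shortExact.extClass_comp_assoc z (h := add_comm 1 a)
  · intro y
    constructor
    · intro hy
      exact Abelian.Ext.contravariant_sequence_exact₃ h.shortExact (ModuleCat.of R W) y hy (add_comm 1 a)
    · rintro ⟨z, rfl⟩
      exact h.shortExact.comp_extClass_assoc z (add_comm 1 a)

lemma les_post {f : A →ₗ[R] B} {g : B →ₗ[R] C} (h : SES f g) (V : Type) [AddCommGroup V]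
    [Module R V] (a : ℕ) : Function.Exact (postX V f a) (postX V g a) := by
  intro y
  constructor
  · intro hy
    exact Abelian.Ext.covariant_sequence_exact₂ (ModuleCat.of R V) h.shortExact y hy
  · rintro ⟨z, rfl⟩
    rw [postX_comp, h.exact.linearMap_comp_eq_zero]
    simp [postX_apply, ModuleCat.ofHom_zero]

lemma les_post_delta {f : A →ₗ[R] B} {g : B →ₗ[R] C} (h : SES f g) (V : Type) [AddCommGroup V]
    [Module R V] (a : ℕ) : ∃ δ : XX R V C a →ₗ[R] XX R V A (a + 1),
      Function.Exact (postX V g a) δ ∧ Function.Exact δ (postX V f (a + 1)) := by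
  refine ⟨Abelian.Ext.postcompOfLinear h.shortExact.extClass R (ModuleCat.of R V) rfl, ?_, ?_⟩
  · intro y
    constructor
    · intro hy
      exact Abelian.Ext.covariant_sequence_exact₃ (ModuleCat.of R V) h.shortExact y rfl hy
    · rintro ⟨z, rfl⟩
      have := h.shortExact.comp_extClass
      change (Abelian.Ext.comp (Abelian.Ext.comp z (Abelian.Ext.mk₀ _) (add_zero a))
        _ (rfl : a + 1 = a + 1)) = 0
      rw [Abelian.Ext.comp_assoc_of_second_deg_zero]
      erw [this]
      simp
  · intro y
    constructor
    · intro hy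
      exact Abelian.Ext.covariant_sequence_exact₁ (ModuleCat.of R V) h.shortExact y hy rfl
    · rintro ⟨z, rfl⟩
      have := h.shortExact.extClass_comp
      change (Abelian.Ext.comp (Abelian.Ext.comp z _ (rfl : a + 1 = a + 1)) (Abelian.Ext.mk₀ _)
        (add_zero (a + 1))) = 0
      rw [Abelian.Ext.comp_assoc_of_third_deg_zero]
      erw [this]
      simp

/-- Degree-zero Ext is Hom. -/
noncomputable def XX0 (A B : Type) [AddCommGroup A] [Module R A]
    [AddCommGroup B] [Module R B] : XX R A B 0 ≃ₗ[R] (A →ₗ[R] B) :=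
  (Abelian.Ext.linearEquiv₀ (R := R)).trans ModuleCat.homLinearEquiv

lemma XX0_symm (f : A →ₗ[R] B) :
    (XX0 A B).symm f = Abelian.Ext.mk₀ (ModuleCat.ofHom f) := rfl

lemma XX0_pre (f : A →ₗ[R] B) (φ : B →ₗ[R] W) :
    preX f W 0 ((XX0 B W).symm φ) = (XX0 A W).symm (φ ∘ₗ f) := by
  rw [preX_apply, XX0_symm, XX0_symm, Abelian.Ext.mk₀_comp_mk₀, ModuleCat.ofHom_comp]

lemma XX0_post (f : A →ₗ[R] B) (φ : V →ₗ[R] A) :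
    postX V f 0 ((XX0 V A).symm φ) = (XX0 V B).symm (f ∘ₗ φ) := by
  rw [postX_apply, XX0_symm, XX0_symm, Abelian.Ext.mk₀_comp_mk₀, ModuleCat.ofHom_comp]

lemma preX0_inj {g : B →ₗ[R] C} (hg : Function.Surjective g) (W : Type) [AddCommGroup W]
    [Module R W] : Function.Injective (preX g W 0) := by
  intro y z hyz
  obtain ⟨y, rfl⟩ := (XX0 C W).symm.surjective y
  obtain ⟨z, rfl⟩ := (XX0 C W).symm.surjective z
  rw [XX0_pre, XX0_pre] at hyz
  have := (XX0 B W).symm.injective hyz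
  rw [LinearMap.cancel_right hg] at this
  rw [this]

lemma postX0_inj {f : A →ₗ[R] B} (hf : Function.Injective f) (V : Type) [AddCommGroup V]
    [Module R V] : Function.Injective (postX V f 0) := by
  intro y z hyz
  obtain ⟨y, rfl⟩ := (XX0 V A).symm.surjective y
  obtain ⟨z, rfl⟩ := (XX0 V A).symm.surjective z
  rw [XX0_post, XX0_post] at hyz
  have := (XX0 V B).symm.injective hyz
  rw [LinearMap.cancel_left hf] at this
  rw [this]

lemma supp_mid {f : A →ₗ[R] B} {g : B →ₗ[R] C} (h : Function.Exact f g) {p : PrimeSpectrum R}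
    (hp : p ∈ Module.support R B) : p ∈ Module.support R A ∨ p ∈ Module.support R C := by
  by_contra hcon
  push Not at hcon
  obtain ⟨hA, hC⟩ := hcon
  rw [Module.mem_support_iff'] at hp
  rw [Module.notMem_support_iff'] at hA hC
  obtain ⟨b, hb⟩ := hp
  obtain ⟨r, hr, hrb⟩ := hC (g b)
  rw [← map_smul] at hrb
  obtain ⟨u, hu⟩ := (h _).1 hrb
  obtain ⟨s, hs, hsu⟩ := hA u
  apply hb (s * r) (fun hm => ((p.2.mem_or_mem hm).elim hs hr))
  rw [mul_smul, ← hu, ← map_smul, hsu, map_zero]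

end ExtMachinery

section SuppTheory

set_option linter.unusedSectionVars false
open scoped Pointwise

variable {R : Type} [CommRing R]
variable {A B C W V : Type} [AddCommGroup A] [Module R A] [AddCommGroup B] [Module R B]
  [AddCommGroup C] [Module R C] [AddCommGroup W] [Module R W] [AddCommGroup V] [Module R V]

/-- Support of `Ext^a(N,R)`. -/
abbrev SE (R : Type) [CommRing R] (N : Type) [AddCommGroup N] [Module R N] (a : ℕ) :
    Set (PrimeSpectrum R) := Module.support R (XX R N R a)

lemma se_B {f : A →ₗ[R] B} {g : B →ₗ[R] C} (h : SES f g) {a : ℕ} {q : PrimeSpectrum R}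
    (hq : q ∈ SE R B a) : q ∈ SE R C a ∨ q ∈ SE R A a :=
  supp_mid (les_pre h R a) hq

lemma se_A {f : A →ₗ[R] B} {g : B →ₗ[R] C} (h : SES f g) {a : ℕ} {q : PrimeSpectrum R}
    (hq : q ∈ SE R A a) : q ∈ SE R B a ∨ q ∈ SE R C (a + 1) := by
  obtain ⟨δ, h1, _⟩ := les_pre_delta h R a
  exact supp_mid h1 hq

lemma se_C {f : A →ₗ[R] B} {g : B →ₗ[R] C} (h : SES f g) {a : ℕ} {q : PrimeSpectrum R}
    (hq : q ∈ SE R C (a + 1)) : q ∈ SE R A a ∨ q ∈ SE R B (a + 1) := by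
  obtain ⟨δ, _, h1⟩ := les_pre_delta h R a
  exact supp_mid h1 hq

lemma se_C0 {g : B →ₗ[R] C} (hg : Function.Surjective g) {q : PrimeSpectrum R}
    (hq : q ∈ SE R C 0) : q ∈ SE R B 0 :=
  Module.support_subset_of_injective _ (preX0_inj hg R) hq

lemma se_congr (e : A ≃ₗ[R] B) (a : ℕ) : SE R A a = SE R B a :=
  (XXcongrLeft e R a).symm.support_eq

lemma xx_subsingleton_left [Subsingleton A] (a : ℕ) : Subsingleton (XX R A W a) := by
  refine subsingleton_of_forall_eq 0 fun y => ?_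
  have h : (LinearMap.id : A →ₗ[R] A) = (0 : R) • LinearMap.id := Subsingleton.elim _ _
  rw [← preX_id a y, h, preX_smul_id, zero_smul]

lemma xx_subsingleton_right [Subsingleton A] (a : ℕ) : Subsingleton (XX R W A a) := by
  refine subsingleton_of_forall_eq 0 fun y => ?_
  have h : (LinearMap.id : A →ₗ[R] A) = (0 : R) • LinearMap.id := Subsingleton.elim _ _
  rw [← postX_id a y, h, postX_smul_id, zero_smul]

lemma se_empty_of_subsingleton [Subsingleton A] (a : ℕ) : SE R A a = ∅ := by
  have := xx_subsingleton_left (R := R) (A := A) (W := R) a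
  exact Module.support_eq_empty

lemma ses_smul {x : R} (hx : IsSMulRegular A x) :
    SES (x • (LinearMap.id : A →ₗ[R] A)) (x • (⊤ : Submodule R A)).mkQ where
  inj := fun a b hab => hx (by simpa using hab)
  exact := by
    intro b
    simp only [Submodule.mkQ_apply, Submodule.Quotient.mk_eq_zero, Set.mem_range]
    rw [Submodule.mem_smul_pointwise_iff_exists]
    simp
  surj := Submodule.mkQ_surjective _

lemma ses_sub (N : Submodule R A) : SES N.subtype N.mkQ where
  inj := Subtype.val_injective
  exact := LinearMap.exact_subtype_mkQ N
  surj := N.mkQ_surjective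

lemma ses_of_quotient (h : SES (R := R) (A := A) (B := B) (C := C) f g)
    (e : C ≃ₗ[R] W) : SES f (e.toLinearMap ∘ₗ g) where
  inj := h.inj
  exact := by
    intro b
    rw [← h.exact b]
    simp
  surj := e.surjective.comp h.surj

lemma support_quotient_mono (N : Submodule R A) :
    Module.support R (A ⧸ N) ⊆ Module.support R A :=
  Module.support_subset_of_surjective _ N.mkQ_surjective

variable [IsNoetherianRing R]

instance xx_finite [Module.Finite R A] [Module.Finite R B] (a : ℕ) :
    Module.Finite R (XX R A B a) :=
  ModuleCat.finite_ext R (ModuleCat.of R A) (ModuleCat.of R B) a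

lemma nak [Module.Finite R A] {x : R} {g : A →ₗ[R] C}
    (h : SES (x • (LinearMap.id : A →ₗ[R] A)) g) {q : PrimeSpectrum R} (hxq : x ∈ q.asIdeal)
    {a : ℕ} (hq : q ∈ SE R A a) : q ∈ SE R C (a + 1) := by
  obtain ⟨δ, h1, h2⟩ := les_pre_delta h R a
  have hker : LinearMap.ker δ = x • (⊤ : Submodule R (XX R A R a)) := by
    ext y
    rw [LinearMap.mem_ker, h1 y, Submodule.mem_smul_pointwise_iff_exists]
    simp [preX_smul_id]
  have hinj : Function.Injective ((x • (⊤ : Submodule R (XX R A R a))).liftQ δ hker.ge) := by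
    rw [← LinearMap.ker_eq_bot, Submodule.ker_liftQ, hker]
    exact Submodule.mkQ_map_self _
  refine Module.support_subset_of_injective _ hinj ?_
  have := Module.support_quotSMulTop (R := R) (M := XX R A R a) x
  change q ∈ Module.support R (QuotSMulTop x (XX R A R a))
  rw [this]
  exact ⟨hq, by simpa using hxq⟩

lemma nak' [Module.Finite R A] {x : R} (hx : IsSMulRegular A x)
    {q : PrimeSpectrum R} (hxq : x ∈ q.asIdeal)
    {a : ℕ} (hq : q ∈ SE R A a) : q ∈ SE R (QuotSMulTop x A) (a + 1) :=
  nak (ses_smul hx) hxq hq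

lemma exists_regular_mem [Module.Finite R A] (I : Ideal R)
    (h : ∀ p ∈ associatedPrimes R A, ¬ I ≤ p) : ∃ y ∈ I, IsSMulRegular A y := by
  by_contra! hcon
  have hsub : (I : Set R) ⊆ ⋃ p ∈ associatedPrimes R A, (p : Set R) := by
    rw [biUnion_associatedPrimes_eq_zero_divisors]
    intro y hy
    have := hcon y hy
    rw [isSMulRegular_iff_right_eq_zero_of_smul] at this
    push Not at this
    obtain ⟨b, hb, hb'⟩ := this
    exact ⟨b, hb', hb⟩
  have fin := associatedPrimes.finite R A
  obtain ⟨P, hP, hIP⟩ := (I.subset_union_prime_finite fin (f := id) 0 0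
    fun _ h _ _ ↦ h.isPrime).1 hsub
  exact h P hP hIP

lemma se_ann {N : Type} [AddCommGroup N] [Module R N] [Module.Finite R N] {q : PrimeSpectrum R}
    {a : ℕ} (hq : q ∈ SE R N a) : q ∈ Module.support R N := by
  rw [Module.mem_support_iff_of_finite]
  refine le_trans ?_ (Module.annihilator_le_of_mem_support hq)
  intro r hr
  rw [Module.mem_annihilator] at hr ⊢
  intro y
  have h : r • (LinearMap.id : N →ₗ[R] N) = (0 : R) • LinearMap.id := by
    ext z; simp [hr z]
  rw [← preX_smul_id, h, preX_smul_id, zero_smul]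

lemma supp_equiv_quot {N : Type} [AddCommGroup N] [Module R N] {p : PrimeSpectrum R}
    (e : N ≃ₗ[R] R ⧸ p.1) (q : PrimeSpectrum R) : q ∈ Module.support R N ↔ p ≤ q := by
  rw [e.support_eq, Module.mem_support_iff_of_finite, Ideal.annihilator_quotient]
  rfl

lemma regular_equiv_quot {N : Type} [AddCommGroup N] [Module R N] {p : PrimeSpectrum R}
    (e : N ≃ₗ[R] R ⧸ p.1) {z : R} (hz : z ∉ p.asIdeal) : IsSMulRegular N z := by
  rw [isSMulRegular_iff_right_eq_zero_of_smul]
  intro u hu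
  have h1 : z • e u = 0 := by rw [← map_smul, hu, map_zero]
  obtain ⟨w, hw⟩ := Ideal.Quotient.mk_surjective (e u)
  rw [← hw, Algebra.smul_def, Ideal.Quotient.algebraMap_eq, ← map_mul,
    Ideal.Quotient.eq_zero_iff_mem] at h1
  rcases p.2.mem_or_mem h1 with h | h
  · exact absurd h hz
  · rw [← e.map_eq_zero_iff, ← hw, Ideal.Quotient.eq_zero_iff_mem]
    exact h

/-- The abstract hypotheses on the ring. -/
structure GH (R : Type) [CommRing R] (n : ℕ) (m : PrimeSpectrum R) : Prop where
  gl : ∀ (N W : Type) [AddCommGroup N] [Module R N] [AddCommGroup W] [Module R W] (a : ℕ),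
    n < a → Subsingleton (XX R N W a)
  kR : ∀ a < n, Subsingleton (XX R (R ⧸ m.asIdeal) R a)
  max : m.asIdeal.IsMaximal

variable {n : ℕ} {m : PrimeSpectrum R}

lemma GH.le (H : GH R n m) {q : PrimeSpectrum R} {a : ℕ} (hq : q ∈ SE R A a) : a ≤ n := by
  by_contra hcon
  have := H.gl A R a (by omega)
  rw [SE, Module.support_eq_empty] at hq
  exact hq

lemma GH.f_coh (H : GH R n m) (N : Type) [AddCommGroup N] [Module R N] [hN : Module.Finite R N]
    (q : PrimeSpectrum R) (a : ℕ) (hq : q ∈ SE R N a) :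
    Order.coheight q ≤ (n - a : ℕ) := by
  have key : ∀ s : ℕ, ∀ a : ℕ, n ≤ a + s → ∀ (N : Type) [AddCommGroup N] [Module R N]
      [Module.Finite R N] (q : PrimeSpectrum R), q ∈ SE R N a →
      Order.coheight q ≤ (n - a : ℕ) ∧ a ≤ n := by
    intro s
    induction s using Nat.strong_induction_on with
    | _ s ih =>
    intro a has N _ _ hN
    have step : ∀ (N : Type) [AddCommGroup N] [Module R N]
      [Module.Finite R N] (q : PrimeSpectrum R), q ∈ SE R N (a + 1) →
      Order.coheight q ≤ (n - (a + 1) : ℕ) ∧ a + 1 ≤ n := by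
      intro N _ _ hN q hq
      have h1 := H.le hq
      exact ih (s - 1) (by omega) (a + 1) (by omega) N q hq
    induction hN using IsNoetherianRing.induction_on_isQuotientEquivQuotientPrime R with
    | subsingleton N =>
      intro q hq
      rw [se_empty_of_subsingleton] at hq
      exact hq.elim
    | quotient N p e =>
      have gen : ∀ q : PrimeSpectrum R, q ∈ SE R N a → p < q →
          Order.coheight q ≤ (n - (a + 1) : ℕ) ∧ a + 1 ≤ n := by
        intro q hq hpq
        obtain ⟨z, hzq, hzp⟩ := SetLike.exists_of_lt (show p.asIdeal < q.asIdeal from hpq)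
        exact step _ q (nak' (regular_equiv_quot e hzp) hzq hq)
      intro q hq
      refine ⟨?_, H.le hq⟩
      rw [Order.coheight_le_coe_iff]
      intro q' hq'
      have h1 : p ≤ q := (supp_equiv_quot e q).1 (se_ann hq)
      have h2 : q' ∈ SE R N a := Module.mem_support_mono hq'.le hq
      obtain ⟨h3, h4⟩ := gen q' h2 (lt_of_le_of_lt h1 hq')
      refine lt_of_le_of_lt h3 ?_
      exact_mod_cast (by omega : n - (a + 1) < n - a)
    | exact N₁ N₂ N₃ f g hf hg hfg h₁ h₃ =>
      intro q hq
      rcases se_B ⟨hf, hfg, hg⟩ hq with h | h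
      · exact h₃ q h
      · exact h₁ q h
  exact (key n a (by omega) N q hq).1

lemma GH.G (H : GH R n m) (N : Type) [AddCommGroup N] [Module R N] [Module.Finite R N]
    (q : PrimeSpectrum R) (hq : q ∈ Module.support R N) : ∃ a, q ∈ SE R N a := by
  by_contra! hcon
  have key : ∀ s a : ℕ, n < a + s → ∀ (A : Type) [AddCommGroup A] [Module R A]
      [Module.Finite R A], q ∉ Module.support R (XX R N A a) := by
    intro s
    induction s with
    | zero =>
      intro a ha A _ _ _
      have := H.gl N A a (by omega)
      rw [Module.support_eq_empty]
      exact id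
    | succ s ih =>
      intro a ha A _ _ hA
      induction hA using IsNoetherianRing.induction_on_isQuotientEquivQuotientPrime R with
      | subsingleton A =>
        have := xx_subsingleton_right (R := R) (A := A) (W := N) a
        rw [Module.support_eq_empty]
        exact id
      | quotient A p e =>
        intro hA
        obtain ⟨δ, h1, h2⟩ := les_post_delta (ses_sub p.asIdeal) N a
        rw [(XXcongrRight N e a).support_eq] at hA
        rcases supp_mid h1 hA with h | h
        · exact hcon a h
        · exact ih (a + 1) (by omega) _ h
      | exact N₁ N₂ N₃ f g hf hg hfg h₁ h₃ =>
        intro hA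
        rcases supp_mid (les_post (⟨hf, hfg, hg⟩ : SES f g) N a) hA with h | h
        · exact h₁ h
        · exact h₃ h
  have h0 := key (n + 1) 0 (by omega) N
  rw [(XX0 N N).support_eq, Module.notMem_support_iff'] at h0
  obtain ⟨r, hr, hr'⟩ := h0 LinearMap.id
  rw [Module.mem_support_iff_of_finite] at hq
  apply hr
  apply hq
  rw [Module.mem_annihilator]
  intro u
  have := LinearMap.congr_fun hr' u
  simpa using this

lemma GH.coheight_le (H : GH R n m) (q : PrimeSpectrum R) : Order.coheight q ≤ n := by
  have hq : q ∈ Module.support R (R ⧸ q.asIdeal) :=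
    (supp_equiv_quot (LinearEquiv.refl R _) q).2 le_rfl
  obtain ⟨a, ha⟩ := H.G _ q hq
  refine (H.f_coh _ q a ha).trans ?_
  exact_mod_cast Nat.sub_le n a

/-- The dimension of a prime, as a natural number. -/
noncomputable def ch (q : PrimeSpectrum R) : ℕ := (Order.coheight q).toNat

lemma GH.coe_ch (H : GH R n m) (q : PrimeSpectrum R) : (ch q : ℕ∞) = Order.coheight q := by
  rw [ch, ENat.natCast_toNat_eq_self]
  intro h
  have := H.coheight_le q
  rw [h] at this
  exact absurd this (by simp)

lemma GH.ch_lt (H : GH R n m) {q q' : PrimeSpectrum R} (h : q < q') : ch q' < ch q := by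
  have := Order.coheight_add_one_le h
  rw [← H.coe_ch, ← H.coe_ch] at this
  have h2 : ch q' + 1 ≤ ch q := by exact_mod_cast this
  omega

lemma GH.ch_anti (H : GH R n m) {q q' : PrimeSpectrum R} (h : q ≤ q') : ch q' ≤ ch q := by
  rcases h.lt_or_eq with h | h
  · exact (H.ch_lt h).le
  · rw [h]

lemma GH.ch_le (H : GH R n m) (q : PrimeSpectrum R) : ch q ≤ n := by
  have := H.coheight_le q
  rw [← H.coe_ch] at this
  exact_mod_cast this

lemma GH.ch_m (H : GH R n m) : ch m = 0 := by
  have : Order.coheight m = 0 := by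
    rw [Order.coheight_eq_zero]
    intro q hq
    have := H.max.eq_of_le q.2.ne_top hq
    exact le_of_eq (PrimeSpectrum.ext this.symm)
  rw [ch, this]; rfl

lemma GH.f (H : GH R n m) {N : Type} [AddCommGroup N] [Module R N] [Module.Finite R N]
    {q : PrimeSpectrum R} {a : ℕ} (hq : q ∈ SE R N a) : ch q + a ≤ n := by
  have h1 := H.f_coh N q a hq
  rw [← H.coe_ch] at h1
  have h2 : ch q ≤ n - a := by exact_mod_cast h1
  have := H.le hq
  omega

lemma GH.fplus (H : GH R n m) {N : Type} [AddCommGroup N] [Module R N] [Module.Finite R N]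
    {d : ℕ} (hN : ∀ p : PrimeSpectrum R, p.asIdeal ∈ associatedPrimes R N → d ≤ ch p)
    {q : PrimeSpectrum R} {a : ℕ} (hq : q ∈ SE R N a) (hqd : ch q < d) : ch q + a + 1 ≤ n := by
  obtain ⟨y, hy, hreg⟩ := exists_regular_mem (A := N) q.asIdeal (by
    intro p hp hle
    have h1 := hN ⟨p, hp.isPrime⟩ hp
    have h2 := H.ch_anti (show q ≤ ⟨p, hp.isPrime⟩ from hle)
    omega)
  have := H.f (nak' hreg hy hq)
  omega

lemma GH.d (H : GH R n m) {e : ℕ} {N : Type} [AddCommGroup N] [Module R N]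
    [hN : Module.Finite R N]
    (hdim : ∀ p ∈ Module.support R N, ch p ≤ e) {a : ℕ} (hm : m ∈ SE R N a) : n ≤ a + e := by
  induction e using Nat.strong_induction_on generalizing a N with
  | _ e ih =>
  induction hN using IsNoetherianRing.induction_on_isQuotientEquivQuotientPrime R with
  | subsingleton N =>
    rw [se_empty_of_subsingleton] at hm
    exact hm.elim
  | quotient N p u =>
    have hpm : p ≤ m := (supp_equiv_quot u m).1 (se_ann hm)
    rcases hpm.lt_or_eq with h | h
    · obtain ⟨z, hzq, hzp⟩ := SetLike.exists_of_lt (show p.asIdeal < m.asIdeal from h)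
      have h1 := nak' (regular_equiv_quot u hzp) hzq hm
      have h2 := hdim p ((supp_equiv_quot u p).2 le_rfl)
      have h3 := H.ch_lt h
      have h4 := ih (e - 1) (by omega) (N := QuotSMulTop z N) (by
        intro q hq
        rw [Module.support_quotSMulTop] at hq
        have h5 : p < q := by
          refine lt_of_le_of_ne ((supp_equiv_quot u q).1 hq.1) ?_
          rintro rfl
          exact hzp (by simpa using hq.2)
        have := H.ch_lt h5
        omega) h1
      omega
    · subst h
      by_contra hcon
      have := H.kR a (by omega)
      rw [se_congr u, SE, Module.support_eq_empty] at hm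
      exact hm
  | exact N₁ N₂ N₃ f g hf hg hfg h₁ h₃ =>
    rcases se_B ⟨hf, hfg, hg⟩ hm with h | h
    · exact h₃ (fun p hp => hdim p (Module.support_subset_of_surjective g hg hp)) h
    · exact h₁ (fun p hp => hdim p (Module.support_subset_of_injective f hf hp)) h

/-- `depth W ≥ t`. -/
def depthGE (m : PrimeSpectrum R) (W : Type) [AddCommGroup W] [Module R W] (t : ℕ) : Prop :=
  ∀ a < t, Subsingleton (XX R (R ⧸ m.asIdeal) W a)

lemma depthGE.mono {W : Type} [AddCommGroup W] [Module R W] {t s : ℕ} (h : depthGE m W t)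
    (hs : s ≤ t) : depthGE m W s := fun a ha => h a (by omega)

lemma depthGE.congr {t : ℕ} (h : depthGE m A t) (e : A ≃ₗ[R] B) : depthGE m B t :=
  fun a ha => have := h a ha; (XXcongrRight (R ⧸ m.asIdeal) e a).symm.toEquiv.subsingleton

lemma subsingleton_mid {f : A →ₗ[R] B} {g : B →ₗ[R] C} (h : Function.Exact f g)
    [Subsingleton A] [Subsingleton C] : Subsingleton B := by
  refine subsingleton_of_forall_eq 0 fun b => ?_
  obtain ⟨a, rfl⟩ := (h b).1 (Subsingleton.elim _ _)
  rw [Subsingleton.elim a 0, map_zero]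

lemma depthGE.mid {f : A →ₗ[R] B} {g : B →ₗ[R] C} (h : SES f g) {t : ℕ}
    (hA : depthGE m A t) (hC : depthGE m C t) : depthGE m B t := by
  intro a ha
  have := hA a ha
  have := hC a ha
  exact subsingleton_mid (les_post h (R ⧸ m.asIdeal) a)

lemma depthGE.right {f : A →ₗ[R] B} {g : B →ₗ[R] C} (h : SES f g) {t : ℕ}
    (hA : depthGE m A (t + 1)) (hB : depthGE m B t) : depthGE m C t := by
  intro a ha
  have := hA (a + 1) (by omega)
  have := hB a ha
  obtain ⟨δ, h1, _⟩ := les_post_delta h (R ⧸ m.asIdeal) a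
  exact subsingleton_mid h1

/-- If `B = A/xA` with `x ∈ m` regular on `A`, depth goes up. -/
lemma depthGE.lift {x : R} (hx : x ∈ m.asIdeal) {g : A →ₗ[R] B}
    (h : SES (x • (LinearMap.id : A →ₗ[R] A)) g) {t : ℕ}
    (hB : depthGE m B t) : depthGE m A (t + 1) := by
  have hzero : ∀ a (y : XX R (R ⧸ m.asIdeal) A a), x • y = 0 := by
    intro a y
    have h0 : x • (LinearMap.id : (R ⧸ m.asIdeal) →ₗ[R] (R ⧸ m.asIdeal)) =
        (0 : R) • LinearMap.id := by
      apply LinearMap.ext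
      intro z
      obtain ⟨z, rfl⟩ := Ideal.Quotient.mk_surjective z
      rw [LinearMap.smul_apply, LinearMap.smul_apply, zero_smul, LinearMap.id_apply,
        Algebra.smul_def, Ideal.Quotient.algebraMap_eq, ← map_mul,
        Ideal.Quotient.eq_zero_iff_mem]
      exact Ideal.mul_mem_right _ _ hx
    rw [← preX_smul_id, h0, preX_smul_id, zero_smul]
  intro a ha
  refine subsingleton_of_forall_eq 0 fun y => ?_
  have hy : postX (R ⧸ m.asIdeal) (x • (LinearMap.id : A →ₗ[R] A)) a y = 0 := by
    rw [postX_smul_id, hzero]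
  cases a with
  | zero =>
    apply postX0_inj h.inj
    rw [hy, map_zero]
  | succ a =>
    obtain ⟨δ, _, h2⟩ := les_post_delta h (R ⧸ m.asIdeal) a
    obtain ⟨z, rfl⟩ := (h2 y).1 hy
    have := hB a (by omega)
    rw [Subsingleton.elim z 0, map_zero]

lemma GH.g (H : GH R n m) {t : ℕ} {W : Type} [AddCommGroup W] [Module R W] [Module.Finite R W]
    (hW : depthGE m W t) {b : ℕ} (hb : m ∈ SE R W b) : b + t ≤ n := by
  induction t generalizing b W with
  | zero => exact H.le hb
  | succ t ih =>
    have h0 := hW 0 (by omega)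
    have h1 : Subsingleton ((R ⧸ m.asIdeal) →ₗ[R] W) := (XX0 _ W).symm.toEquiv.subsingleton
    rw [IsSMulRegular.subsingleton_linearMap_iff] at h1
    obtain ⟨y, hy, hreg⟩ := h1
    rw [Ideal.annihilator_quotient] at hy
    have := ih (depthGE.right (ses_smul hreg) hW (hW.mono (by omega))) (nak' hreg hy hb)
    omega

lemma GH.depth_le_dim (H : GH R n m) {e : ℕ} {W : Type} [AddCommGroup W] [Module R W]
    [Module.Finite R W] (hdim : ∀ p ∈ Module.support R W, ch p ≤ e)
    (hm : m ∈ Module.support R W) : ¬ depthGE m W (e + 1) := by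
  intro hW
  obtain ⟨a, ha⟩ := H.G W m hm
  have h1 := H.d hdim ha
  have h2 := H.g hW ha
  omega

end SuppTheory

section GlobalDim

open TensorProduct

/-- Global dimension at most `d`. -/
def GLD (S : Type) [CommRing S] (d : ℕ) : Prop :=
  ∀ (N : Type) [AddCommGroup N] [Module S N], HasProjectiveDimensionLE (ModuleCat.of S N) d

lemma gld_field (k : Type) [Field k] : GLD k 0 := by
  intro N _ _
  rw [← projective_iff_hasProjectiveDimensionLE_zero, ← IsProjective.iff_projective]
  infer_instance

attribute [local instance] RingHomInvPair.of_ringEquiv in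
lemma gld_equiv {S T : Type} [CommRing S] [CommRing T] (e : S ≃+* T) {d : ℕ} (h : GLD S d) :
    GLD T d := by
  intro N _ _
  let _ : Module S N := Module.compHom N (e : S →+* T)
  have := h N
  let u : (ModuleCat.of S N) ≃ₛₗ[RingHomClass.toRingHom e] (ModuleCat.of T N) :=
    { toFun := fun x => x
      invFun := fun x => x
      left_inv := fun _ => rfl
      right_inv := fun _ => rfl
      map_add' := fun _ _ => rfl
      map_smul' := fun _ _ => rfl }
  exact ModuleCat.hasProjectiveDimensionLE_of_semiLinearEquiv e u d

lemma ses_ker {S A B : Type} [CommRing S] [AddCommGroup A] [Module S A] [AddCommGroup B]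
    [Module S B] (g : A →ₗ[S] B) (hg : Function.Surjective g) :
    SES (LinearMap.ker g).subtype g := by
  refine ⟨Subtype.val_injective, ?_, hg⟩
  intro x
  constructor
  · intro hx; exact ⟨⟨x, hx⟩, rfl⟩
  · rintro ⟨y, rfl⟩; exact y.2

open TensorProduct in
lemma ses_baseChange {S T A B C : Type} [CommRing S] [CommRing T] [Algebra S T] [Module.Flat S T]
    [AddCommGroup A] [Module S A] [AddCommGroup B] [Module S B] [AddCommGroup C] [Module S C]
    {f : A →ₗ[S] B} {g : B →ₗ[S] C} (h : SES f g) :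
    SES (f.baseChange T) (g.baseChange T) := by
  have h1 := lTensor_exact T h.exact h.surj
  have h2 := LinearMap.lTensor_surjective T h.surj
  have h3 := Module.Flat.lTensor_preserves_injective_linearMap (M := T) f h.inj
  exact ⟨h3, h1, h2⟩

lemma pd_baseChange {S T : Type} [CommRing S] [CommRing T] [Algebra S T] [Module.Flat S T]
    (d : ℕ) : ∀ (N : Type) [AddCommGroup N] [Module S N],
    HasProjectiveDimensionLE (ModuleCat.of S N) d →
    HasProjectiveDimensionLE (ModuleCat.of T (T ⊗[S] N)) d := by
  induction d with
  | zero =>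
    intro N _ _ h
    rw [← projective_iff_hasProjectiveDimensionLE_zero, ← IsProjective.iff_projective] at h ⊢
    infer_instance
  | succ d ih =>
    intro N _ _ h
    let g : (N →₀ S) →ₗ[S] N := Finsupp.linearCombination S id
    have hg : Function.Surjective g := Finsupp.linearCombination_id_surjective S N
    have hs := ses_ker g hg
    have hs' := ses_baseChange (T := T) hs
    have hK := (hs.shortExact.hasProjectiveDimensionLT_X₃_iff d (by
      change Projective (ModuleCat.of S (N →₀ S))
      rw [← IsProjective.iff_projective]
      infer_instance)).1 h
    exact (hs'.shortExact.hasProjectiveDimensionLT_X₃_iff d (by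
      change Projective (ModuleCat.of T (T ⊗[S] (N →₀ S)))
      rw [← IsProjective.iff_projective]
      infer_instance)).2 (ih (LinearMap.ker g) hK)

open Polynomial in
lemma gld_polynomial {S : Type} [CommRing S] {d : ℕ} (h : GLD S d) : GLD S[X] (d + 1) := by
  intro N _ _
  let _ : Module S N := Module.compHom N (C : S →+* S[X])
  have : IsScalarTower S S[X] N := ⟨fun a b c => by
    change (a • b) • c = (C a : S[X]) • (b • c)
    rw [Polynomial.smul_eq_C_mul, mul_smul]⟩
  let mX : N →ₗ[S] N := ((X : S[X]) • (LinearMap.id : N →ₗ[S[X]] N)).restrictScalars S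
  have hmX : ∀ z, mX z = (X : S[X]) • z := fun _ => rfl
  let β : S[X] ⊗[S] N →ₗ[S[X]] N := LinearMap.liftBaseChange S[X] (LinearMap.id : N →ₗ[S] N)
  have hβ : ∀ (p : S[X]) (z : N), β (p ⊗ₜ[S] z) = p • z := fun _ _ => rfl
  let α : S[X] ⊗[S] N →ₗ[S[X]] S[X] ⊗[S] N :=
    (X : S[X]) • LinearMap.id - mX.baseChange S[X]
  have hα : ∀ (p : S[X]) (z : N), α (p ⊗ₜ[S] z) = (X * p) ⊗ₜ[S] z - p ⊗ₜ[S] ((X : S[X]) • z) := by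
    intro p z
    simp [α, smul_tmul', hmX]
  have hs : SES α β := by
    refine ⟨?_, ?_, ?_⟩
    · let e := PolynomialModule.polynomialTensorProductLEquivPolynomialModule S N
      have he : ∀ (p : S[X]) (z : N) (i : ℕ), (e (p ⊗ₜ[S] z)).coeff i = p.coeff i • z := by
        intro p z i
        have : e (p ⊗ₜ[S] z) = p • PolynomialModule.single S 0 z := rfl
        rw [this, PolynomialModule.smul_single_apply]
        simp
      have hc : ∀ t i, (e (α t)).coeff (i + 1) = (e t).coeff i - (X : S[X]) • (e t).coeff (i + 1) := by
        intro t i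
        induction t with
        | zero => simp
        | tmul p z =>
          rw [hα, map_sub]
          change (e _).coeff _ - (e _).coeff _ = _
          rw [he, he, he, he, coeff_X_mul, smul_comm]
        | add s t hs ht =>
          simp only [map_add, PolynomialModule.coeff_add, Finsupp.add_apply, hs, ht, smul_add]
          abel
      rw [injective_iff_map_eq_zero]
      intro t ht
      apply e.injective
      rw [map_zero]
      have key : ∀ s i, (∀ j, i + s ≤ j → (e t).coeff j = 0) → (e t).coeff i = 0 := by
        intro s
        induction s with
        | zero => intro i hi; exact hi i (by omega)
        | succ s ih =>
          intro i hi
          have h1 := ih (i + 1) (fun j hj => hi j (by omega))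
          have h2 := hc t i
          rw [ht, h1, smul_zero, sub_zero] at h2
          simpa using h2.symm
      ext i
      refine key ((e t).coeff.support.sup id + 1) i (fun j hj => ?_)
      by_contra hne
      have h3 : j ∈ (e t).coeff.support := Finsupp.mem_support_iff.2 hne
      have h4 := Finset.le_sup (f := id) h3
      simp only [id] at h4
      omega
    · have hcomp : ∀ t, β (α t) = 0 := by
        intro t
        induction t with
        | zero => simp
        | tmul p z =>
          rw [hα, map_sub, hβ, hβ, smul_smul, mul_comm, sub_self]
        | add s t hs ht => rw [map_add, map_add, hs, ht, add_zero]
      have hred : ∀ t, ∃ s, t = α s + (1 : S[X]) ⊗ₜ[S] β t := by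
        intro t
        induction t with
        | zero => exact ⟨0, by simp⟩
        | tmul p z =>
          induction p using Polynomial.induction_on' generalizing z with
          | add p q hp hq =>
            obtain ⟨s, hs⟩ := hp z
            obtain ⟨s', hs'⟩ := hq z
            refine ⟨s + s', ?_⟩
            rw [add_tmul, map_add, map_add, tmul_add]
            nth_rw 1 [hs, hs']
            abel
          | monomial i a =>
            induction i generalizing z with
            | zero =>
              refine ⟨0, ?_⟩
              rw [map_zero, zero_add, hβ, monomial_zero_left]
              have : (C a : S[X]) = a • 1 := by rw [Polynomial.smul_eq_C_mul, mul_one]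
              rw [this, smul_tmul, smul_assoc, one_smul]
            | succ i ih =>
              obtain ⟨s, hs⟩ := ih ((X : S[X]) • z)
              refine ⟨(monomial i a : S[X]) ⊗ₜ[S] z + s, ?_⟩
              rw [map_add, hα, add_assoc]
              have h1 : β (monomial (i + 1) a ⊗ₜ[S] z) =
                  β ((monomial i a) ⊗ₜ[S] ((X : S[X]) • z)) := by
                rw [hβ, hβ, smul_smul, monomial_mul_X]
              rw [h1, ← hs, X_mul_monomial]
              abel
        | add s t hs ht =>
          obtain ⟨u, hu⟩ := hs
          obtain ⟨v, hv⟩ := ht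
          refine ⟨u + v, ?_⟩
          rw [map_add, map_add, tmul_add]
          nth_rw 1 [hu, hv]
          abel
      intro t
      constructor
      · intro ht
        obtain ⟨s, hs⟩ := hred t
        exact ⟨s, by rw [hs, ht, tmul_zero, add_zero]⟩
      · rintro ⟨s, rfl⟩
        exact hcomp s
    · intro z
      exact ⟨1 ⊗ₜ z, by rw [hβ, one_smul]⟩
  have h1 := pd_baseChange (S := S) (T := S[X]) d N (h N)
  exact hs.shortExact.hasProjectiveDimensionLT_X₃ (d + 1) h1
    (hasProjectiveDimensionLT_of_ge _ (d + 1) (d + 1 + 1) (by omega))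

lemma gld_mvPolynomial (k : Type) [Field k] (n : ℕ) : GLD (MvPolynomial (Fin n) k) n := by
  induction n with
  | zero => exact gld_equiv (MvPolynomial.isEmptyAlgEquiv k (Fin 0)).symm.toRingEquiv (gld_field k)
  | succ n ih =>
    exact gld_equiv (MvPolynomial.finSuccEquiv k n).symm.toRingEquiv (gld_polynomial ih)

end GlobalDim

section KoszulVanish

open MvPolynomial

lemma irr_reg (k : Type) [Field k] (n : ℕ) (j : ℕ) (hj : j < n) :
    IsSMulRegular ((MvPolynomial (Fin n) k) ⧸ (Ideal.span
      ((X : Fin n → MvPolynomial (Fin n) k) '' {i | (i : ℕ) < j})))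
      (X ⟨j, hj⟩ : MvPolynomial (Fin n) k) := by
  rw [isSMulRegular_iff_right_eq_zero_of_smul]
  intro u hu
  obtain ⟨u, rfl⟩ := Ideal.Quotient.mk_surjective u
  change Ideal.Quotient.mk _ (X ⟨j, hj⟩ * u) = 0 at hu
  rw [Ideal.Quotient.eq_zero_iff_mem, mem_ideal_span_X_image] at hu
  rw [Ideal.Quotient.eq_zero_iff_mem, mem_ideal_span_X_image]
  intro d hd
  obtain ⟨i, hi, hid⟩ := hu (Finsupp.single ⟨j, hj⟩ 1 + d) (by
    rw [mem_support_iff, coeff_X_mul]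
    exact mem_support_iff.1 hd)
  refine ⟨i, hi, ?_⟩
  have : i ≠ ⟨j, hj⟩ := by
    rintro rfl
    simp at hi
  simpa [Finsupp.single_apply, this.symm] using hid

lemma span_lt_succ (k : Type) [Field k] (n : ℕ) (j : ℕ) (hj : j < n) :
    Ideal.span ((X : Fin n → MvPolynomial (Fin n) k) '' {i | (i : ℕ) < j + 1}) =
    Ideal.span ((X : Fin n → MvPolynomial (Fin n) k) '' {i | (i : ℕ) < j}) ⊔
      Ideal.span {X ⟨j, hj⟩} := by
  rw [← Ideal.span_union]
  congr 1
  rw [← Set.image_singleton, ← Set.image_union]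
  congr 1
  ext i
  simp only [Set.mem_ofPred_eq, Set.mem_union, Set.mem_singleton_iff, Fin.ext_iff]
  omega

lemma depth_partial (k : Type) [Field k] (n : ℕ) (m : PrimeSpectrum (MvPolynomial (Fin n) k))
    (hm : m.asIdeal = irrIdeal k n) (s : ℕ) : ∀ j, j + s = n →
    depthGE m ((MvPolynomial (Fin n) k) ⧸ (Ideal.span
      ((X : Fin n → MvPolynomial (Fin n) k) '' {i | (i : ℕ) < j}))) s := by
  induction s with
  | zero => intro j _ a ha; omega
  | succ s ih =>
    intro j hj
    have h1 := ih (j + 1) (by omega)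
    have hjn : j < n := by omega
    have hreg := irr_reg k n j hjn
    set I := Ideal.span ((X : Fin n → MvPolynomial (Fin n) k) '' {i | (i : ℕ) < j}) with hI
    set J := Ideal.span ((X : Fin n → MvPolynomial (Fin n) k) '' {i | (i : ℕ) < j + 1}) with hJ
    have hIJ : J = I ⊔ Ideal.span {X ⟨j, hjn⟩} := span_lt_succ k n j hjn
    have hle : I ≤ J := hIJ ▸ le_sup_left
    let g : ((MvPolynomial (Fin n) k) ⧸ I) →ₗ[MvPolynomial (Fin n) k]
      ((MvPolynomial (Fin n) k) ⧸ J) := Submodule.mapQ I J LinearMap.id hle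
    have hg : ∀ u, g (Ideal.Quotient.mk I u) = Ideal.Quotient.mk J u := fun _ => rfl
    refine depthGE.lift (x := X ⟨j, hjn⟩) (g := g) ?_ ?_ h1
    · rw [hm]
      exact Ideal.subset_span ⟨_, rfl⟩
    · refine ⟨?_, ?_, ?_⟩
      · intro a b hab
        exact hreg (by simpa using hab)
      · intro u
        obtain ⟨u, rfl⟩ := Ideal.Quotient.mk_surjective u
        rw [hg, Ideal.Quotient.eq_zero_iff_mem, hIJ, sup_comm, Ideal.mem_span_singleton_sup]
        constructor
        · rintro ⟨a, b, hb, rfl⟩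
          refine ⟨Ideal.Quotient.mk I a, ?_⟩
          change Ideal.Quotient.mk I (X ⟨j, hjn⟩ * a) = _
          rw [Ideal.Quotient.eq]
          have : X ⟨j, hjn⟩ * a - (a * X ⟨j, hjn⟩ + b) = -b := by ring
          rw [this]
          exact I.neg_mem hb
        · rintro ⟨v, hv⟩
          obtain ⟨v, rfl⟩ := Ideal.Quotient.mk_surjective v
          change Ideal.Quotient.mk I (X ⟨j, hjn⟩ * v) = _ at hv
          rw [Ideal.Quotient.eq] at hv
          exact ⟨v, _, I.neg_mem hv, by ring⟩
      · intro v
        obtain ⟨v, rfl⟩ := Ideal.Quotient.mk_surjective v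
        exact ⟨Ideal.Quotient.mk I v, rfl⟩

end KoszulVanish

section Comparison

variable {R : Type} [CommRing R]

/-- homology of a short complex of modules, from a presentation. -/
noncomputable def homologyEquivOf (S : ShortComplex (ModuleCat.{0} R)) (E : Type) [AddCommGroup E]
    [Module R E] (φ : LinearMap.ker S.g.hom →ₗ[R] E) (hs : Function.Surjective φ)
    (hk : ∀ z, φ z = 0 ↔ ∃ y, S.f.hom y = z.1) : S.homology ≃ₗ[R] E :=
  S.moduleCatHomologyIso.toLinearEquiv ≪≫ₗ
    (Submodule.quotEquivOfEq _ (LinearMap.ker φ) (by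
      ext z
      rw [LinearMap.mem_ker, hk, LinearMap.mem_range]
      constructor
      · rintro ⟨y, hy⟩
        exact ⟨y, by rw [← hy]; rfl⟩
      · rintro ⟨y, hy⟩
        exact ⟨y, Subtype.ext hy⟩)) ≪≫ₗ φ.quotKerEquivOfSurjective hs

lemma extMk_zero_degree {X Y : ModuleCat.{0} R} (P : ProjectiveResolution X)
    (f : P.complex.X 0 ⟶ Y) (hf : P.complex.d 1 0 ≫ f = 0) :
    P.extMk (n := 0) f 1 rfl hf = 0 ↔ f = 0 := by
  constructor
  · intro h
    simp only [← P.extEquivCohomologyClass.apply_eq_iff_eq,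
      ProjectiveResolution.extEquivCohomologyClass_extMk,
      ProjectiveResolution.extEquivCohomologyClass_zero,
      CochainComplex.HomComplex.CohomologyClass.mk_eq_zero_iff] at h
    rw [CochainComplex.HomComplex.Cocycle.toSingleMk_mem_coboundaries_iff _ _ _ _ _ 1 (by simp)] at h
    obtain ⟨g, hg⟩ := h
    have hz : Limits.IsZero (P.cochainComplex.X 1) :=
      P.cochainComplex.isZero_of_isStrictlyLE 0 1 (by simp)
    rw [hz.eq_of_src g 0, Limits.comp_zero] at hg
    rw [← cancel_epi (P.cochainComplexXIso (-(0 : ℕ)) 0 rfl).hom, ← hg, Limits.comp_zero]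
  · rintro rfl
    exact P.extMk_zero 1 rfl

lemma lyd_apply {X Y : ModuleCat.{0} R} (P : ProjectiveResolution X) (i j : ℕ)
    (z : P.complex.X i ⟶ Y) :
    ((P.complex.linearYonedaObj R Y).d i j).hom z = P.complex.d j i ≫ z := rfl

lemma cmp_g {X Y : ModuleCat.{0} R} (P : ProjectiveResolution X) (a : ℕ)
    (z : P.complex.X a ⟶ Y) :
    ((P.complex.linearYonedaObj R Y).sc a).g.hom z = 0 ↔ P.complex.d (a + 1) a ≫ z = 0 := by
  change ((P.complex.linearYonedaObj R Y).d a ((ComplexShape.up ℕ).next a)).hom z = 0 ↔ _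
  rw [CochainComplex.next]
  rw [lyd_apply]
  rfl

lemma cmp_f_succ {X Y : ModuleCat.{0} R} (P : ProjectiveResolution X) (a : ℕ)
    (z : P.complex.X (a + 1) ⟶ Y) :
    (∃ y, ((P.complex.linearYonedaObj R Y).sc (a + 1)).f.hom y = z) ↔
      ∃ g : P.complex.X a ⟶ Y, P.complex.d (a + 1) a ≫ g = z := by
  change (∃ y, ((P.complex.linearYonedaObj R Y).d ((ComplexShape.up ℕ).prev (a + 1))
    (a + 1)).hom y = z) ↔ _
  rw [CochainComplex.prev_nat_succ]
  rfl

lemma cmp_f_zero {X Y : ModuleCat.{0} R} (P : ProjectiveResolution X)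
    (z : P.complex.X 0 ⟶ Y) :
    (∃ y, ((P.complex.linearYonedaObj R Y).sc 0).f.hom y = z) ↔ z = 0 := by
  change (∃ y, ((P.complex.linearYonedaObj R Y).d ((ComplexShape.up ℕ).prev 0)
    0).hom y = z) ↔ _
  rw [(P.complex.linearYonedaObj R Y).shape _ _ (by simp)]
  constructor
  · rintro ⟨y, hy⟩
    rw [← hy]; rfl
  · rintro rfl
    exact ⟨0, rfl⟩

lemma smul_extMk {X Y : ModuleCat.{0} R} (P : ProjectiveResolution X) (a : ℕ) (r : R)
    (z : P.complex.X a ⟶ Y) (h : P.complex.d (a + 1) a ≫ z = 0)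
    (h' : P.complex.d (a + 1) a ≫ (r • z) = 0) :
    P.extMk (n := a) (r • z) (a + 1) rfl h' = r • P.extMk (n := a) z (a + 1) rfl h := by
  rw [Abelian.Ext.smul_eq_comp_mk₀, P.extMk_comp_mk₀]
  simp only [Linear.comp_smul, Category.comp_id]

/-- comparison map -/
noncomputable def cmpMap {X Y : ModuleCat.{0} R} (P : ProjectiveResolution X) (a : ℕ) :
    LinearMap.ker ((P.complex.linearYonedaObj R Y).sc a).g.hom →ₗ[R] Abelian.Ext.{0} X Y a where
  toFun z := P.extMk (n := a) (z.1 : P.complex.X a ⟶ Y) (a + 1) rfl ((cmp_g P a z.1).1 z.2)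
  map_add' z w := (P.add_extMk _ _ _ _ _ _).symm
  map_smul' r z := smul_extMk P a r z.1 ((cmp_g P a z.1).1 z.2) _

/-- The two definitions of Ext agree. -/
noncomputable def extCEquiv (a : ℕ) (A B : Type) [AddCommGroup A] [Module R A] [AddCommGroup B]
    [Module R B] : extC R a A B ≃ₗ[R] XX R A B a :=
  let P := (HasProjectiveResolution.out (Z := ModuleCat.of R A)).some
  (P.isoExt a (ModuleCat.of R B)).toLinearEquiv ≪≫ₗ
    homologyEquivOf ((P.complex.linearYonedaObj R (ModuleCat.of R B)).sc a) _ (cmpMap P a)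
      (by
        intro α
        obtain ⟨f, hf, rfl⟩ := P.extMk_surjective α (a + 1) rfl
        exact ⟨⟨f, (cmp_g P a f).2 hf⟩, rfl⟩)
      (by
        intro z
        cases a with
        | zero =>
          exact (extMk_zero_degree P z.1 ((cmp_g P 0 z.1).1 z.2)).trans (cmp_f_zero P z.1).symm
        | succ a =>
          exact (P.extMk_eq_zero_iff z.1 (a + 1 + 1) rfl ((cmp_g P (a + 1) z.1).1 z.2) a rfl).trans
            (cmp_f_succ P a z.1).symm)

lemma depthGE_of_mDepth {m : PrimeSpectrum R} {W : Type} [AddCommGroup W] [Module R W] {t : ℕ}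
    (h : (t : ℕ∞) ≤ mDepth R m.asIdeal W) : depthGE m W t := by
  intro a ha
  by_contra hcon
  rw [not_subsingleton_iff_nontrivial] at hcon
  have h1 : Nontrivial (extC R a (R ⧸ m.asIdeal) W) :=
    (extCEquiv a (R ⧸ m.asIdeal) W).toEquiv.nontrivial
  have h2 : mDepth R m.asIdeal W ≤ (a : ℕ∞) := sInf_le ⟨a, rfl, h1⟩
  have h3 := h.trans h2
  have : t ≤ a := by exact_mod_cast h3
  omega

lemma mDepth_of_depthGE {m : PrimeSpectrum R} {W : Type} [AddCommGroup W] [Module R W] {t : ℕ}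
    (h : depthGE m W t) : (t : ℕ∞) ≤ mDepth R m.asIdeal W := by
  refine le_sInf ?_
  rintro _ ⟨a, rfl, ha⟩
  by_contra hcon
  have h1 : a < t := by
    rw [not_le] at hcon
    exact_mod_cast hcon
  have h2 := h a h1
  have h3 : Nontrivial (XX R (R ⧸ m.asIdeal) W a) :=
    (extCEquiv a (R ⧸ m.asIdeal) W).symm.toEquiv.nontrivial
  exact not_subsingleton _ h2

lemma not_ass_of_depthGE {m : PrimeSpectrum R} {W : Type} [AddCommGroup W] [Module R W]
    (h : depthGE m W 1) : ¬ ∃ w : W, w ≠ 0 ∧ ∀ r ∈ m.asIdeal, r • w = 0 := by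
  rintro ⟨w, hw, hr⟩
  have h1 := h 0 (by omega)
  have h2 : Subsingleton ((R ⧸ m.asIdeal) →ₗ[R] W) := (XX0 (R ⧸ m.asIdeal) W).symm.toEquiv.subsingleton
  let f : (R ⧸ m.asIdeal) →ₗ[R] W := m.asIdeal.liftQ (LinearMap.toSpanSingleton R W w) (by
    intro r hrm
    rw [LinearMap.mem_ker, LinearMap.toSpanSingleton_apply]
    exact hr r hrm)
  have h3 : f = 0 := Subsingleton.elim _ _
  apply hw
  have h4 : f (Submodule.Quotient.mk 1) = 0 := by rw [h3]; rfl
  change (1 : R) • w = 0 at h4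
  rwa [one_smul] at h4

end Comparison

section GHPoly

open MvPolynomial

lemma mem_irrIdeal (k : Type) [Field k] (n : ℕ) (f : MvPolynomial (Fin n) k) :
    f ∈ irrIdeal k n ↔ coeff 0 f = 0 := by
  have := mem_pow_idealOfVars_iff' (σ := Fin n) (R := k) 1 f
  rw [pow_one] at this
  refine this.trans ⟨fun h => h 0 (by simp), fun h x hx => ?_⟩
  have : x = 0 := by
    rw [← Finsupp.degree_eq_zero_iff]; omega
  rw [this, h]

lemma irrIdeal_maximal (k : Type) [Field k] (n : ℕ) : (irrIdeal k n).IsMaximal := by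
  have : irrIdeal k n = RingHom.ker (constantCoeff (σ := Fin n) (R := k)) := by
    ext f
    rw [mem_irrIdeal, RingHom.mem_ker, constantCoeff_eq]
  rw [this]
  exact RingHom.ker_isMaximal_of_surjective _ (fun c => ⟨C c, constantCoeff_C _ _⟩)

/-- the irrelevant ideal as a point of the spectrum -/
noncomputable def mP (k : Type) [Field k] (n : ℕ) : PrimeSpectrum (MvPolynomial (Fin n) k) :=
  ⟨irrIdeal k n, (irrIdeal_maximal k n).isPrime⟩

lemma gh_poly (k : Type) [Field k] (n : ℕ) : GH (MvPolynomial (Fin n) k) n (mP k n) where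
  gl := by
    intro N W _ _ _ _ a ha
    have := gld_mvPolynomial k n N
    exact HasProjectiveDimensionLT.subsingleton (ModuleCat.of (MvPolynomial (Fin n) k) N) (n + 1) a ha _
  kR := by
    have h := depth_partial k n (mP k n) rfl n 0 (by omega)
    have h0 : Ideal.span ((X : Fin n → MvPolynomial (Fin n) k) '' {i | (i : ℕ) < 0}) = ⊥ := by
      simp
    rw [h0] at h
    exact h.congr (Submodule.quotEquivOfEqBot ⊥ rfl)
  max := irrIdeal_maximal k n

end GHPoly

section SubQuots

set_option linter.unusedSectionVars false

variable {R : Type} [CommRing R] {M : Type} [AddCommGroup M] [Module R M]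

/-- class of an element in a subquotient -/
def sqMk (A : Submodule R M) {B : Submodule R M} (b : M) (hb : b ∈ B) : subQuot R A B :=
  Submodule.Quotient.mk ⟨b, hb⟩

lemma sqMk_zero_iff {A B : Submodule R M} {b : M} (hb : b ∈ B) : sqMk A b hb = 0 ↔ b ∈ A := by
  rw [sqMk, Submodule.Quotient.mk_eq_zero, Submodule.mem_comap]
  rfl

lemma sq_exists {A B : Submodule R M} (u : subQuot R A B) : ∃ b, ∃ hb : b ∈ B, u = sqMk A b hb := by
  obtain ⟨⟨b, hb⟩, rfl⟩ := Submodule.Quotient.mk_surjective _ u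
  exact ⟨b, hb, rfl⟩

lemma smul_sqMk {A B : Submodule R M} (r : R) {b : M} (hb : b ∈ B) :
    r • sqMk A b hb = sqMk A (r • b) (B.smul_mem r hb) := rfl

lemma sqMk_sub {A B : Submodule R M} {b c : M} (hb : b ∈ B) (hc : c ∈ B) :
    sqMk A b hb - sqMk A c hc = sqMk A (b - c) (B.sub_mem hb hc) := rfl

lemma sqMk_eq_iff {A B : Submodule R M} {b c : M} (hb : b ∈ B) (hc : c ∈ B) :
    sqMk A b hb = sqMk A c hc ↔ b - c ∈ A := by
  rw [← sub_eq_zero, sqMk_sub, sqMk_zero_iff]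

/-- functoriality of subquotients -/
def sqMap {A A' B B' : Submodule R M} (hA : A ≤ A') (hB : B ≤ B') :
    subQuot R A B →ₗ[R] subQuot R A' B' :=
  Submodule.mapQ _ _ (Submodule.inclusion hB) (by
    intro z hz
    exact hA hz)

lemma sqMap_mk {A A' B B' : Submodule R M} (hA : A ≤ A') (hB : B ≤ B') {b : M} (hb : b ∈ B) :
    sqMap hA hB (sqMk A b hb) = sqMk A' b (hB hb) := rfl

lemma sq_ses {A B C : Submodule R M} (hAB : A ≤ B) (hBC : B ≤ C) :
    SES (sqMap (le_refl A) hBC) (sqMap hAB (le_refl C)) := by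
  refine ⟨?_, ?_, ?_⟩
  · rw [injective_iff_map_eq_zero]
    intro u hu
    obtain ⟨b, hb, rfl⟩ := sq_exists u
    rw [sqMap_mk, sqMk_zero_iff] at hu
    rwa [sqMk_zero_iff]
  · intro u
    obtain ⟨b, hb, rfl⟩ := sq_exists u
    rw [sqMap_mk, sqMk_zero_iff]
    constructor
    · intro h
      exact ⟨sqMk A b h, rfl⟩
    · rintro ⟨v, hv⟩
      obtain ⟨c, hc, rfl⟩ := sq_exists v
      rw [sqMap_mk, sqMk_eq_iff] at hv
      have := B.sub_mem hc (hAB hv)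
      rwa [sub_sub_cancel] at this
  · intro u
    obtain ⟨b, hb, rfl⟩ := sq_exists u
    exact ⟨sqMk A b hb, rfl⟩

lemma sq_subsingleton_iff {A B : Submodule R M} : Subsingleton (subQuot R A B) ↔ B ≤ A := by
  constructor
  · intro h b hb
    exact (sqMk_zero_iff hb).1 (Subsingleton.elim _ _)
  · intro h
    refine subsingleton_of_forall_eq 0 fun u => ?_
    obtain ⟨b, hb, rfl⟩ := sq_exists u
    exact (sqMk_zero_iff hb).2 (h hb)

/-- multiplication by `x` on a subquotient with regular outer quotients -/
lemma sq_ses_smul {x : R} {A A' X : Submodule R M} (hX : ∀ w, w ∈ X ↔ ∃ v, w = x • v)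
    (hAA : A ≤ A') (h1 : ∀ w, x • w ∈ A → w ∈ A) (h2 : ∀ w, x • w ∈ A' → w ∈ A') :
    SES (x • (LinearMap.id : subQuot R A A' →ₗ[R] subQuot R A A'))
      (sqMap (le_sup_left : A ≤ A ⊔ X) (le_sup_left : A' ≤ A' ⊔ X)) := by
  refine ⟨?_, ?_, ?_⟩
  · rw [injective_iff_map_eq_zero]
    intro u hu
    obtain ⟨b, hb, rfl⟩ := sq_exists u
    rw [LinearMap.smul_apply, LinearMap.id_apply, smul_sqMk, sqMk_zero_iff] at hu
    rw [sqMk_zero_iff]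
    exact h1 _ hu
  · intro u
    obtain ⟨b, hb, rfl⟩ := sq_exists u
    rw [sqMap_mk, sqMk_zero_iff]
    constructor
    · intro h
      obtain ⟨a, ha, z, hz, hb'⟩ := Submodule.mem_sup.1 h
      obtain ⟨v, rfl⟩ := (hX z).1 hz
      have hv : v ∈ A' := h2 v (by
        have := A'.sub_mem hb (hAA ha)
        rwa [← hb', add_sub_cancel_left] at this)
      refine ⟨sqMk A v hv, ?_⟩
      rw [LinearMap.smul_apply, LinearMap.id_apply, smul_sqMk, sqMk_eq_iff, ← hb']
      rw [sub_add_cancel_right]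
      exact A.neg_mem ha
    · rintro ⟨v, hv⟩
      obtain ⟨c, hc, rfl⟩ := sq_exists v
      rw [LinearMap.smul_apply, LinearMap.id_apply, smul_sqMk, sqMk_eq_iff] at hv
      have h3 : x • c ∈ X := (hX _).2 ⟨c, rfl⟩
      have := (A ⊔ X).sub_mem (Submodule.mem_sup_right h3) (Submodule.mem_sup_left hv)
      rwa [sub_sub_cancel] at this
  · intro u
    obtain ⟨b, hb, rfl⟩ := sq_exists u
    obtain ⟨a, ha, z, hz, rfl⟩ := Submodule.mem_sup.1 hb
    refine ⟨sqMk A a ha, ?_⟩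
    rw [sqMap_mk, sqMk_eq_iff, sub_add_cancel_left]
    exact Submodule.neg_mem _ (Submodule.mem_sup_right hz)

lemma sq_supp_mono {A A' B B' : Submodule R M} (hA : A ≤ A') (hB : B ≤ B')
    : Module.support R (subQuot R A' B) ⊆ Module.support R (subQuot R A B') := by
  refine Set.Subset.trans (Module.support_subset_of_surjective (sqMap hA (le_refl B)) ?_)
    (Module.support_subset_of_injective (sqMap (le_refl A) hB) ?_)
  · intro u
    obtain ⟨b, hb, rfl⟩ := sq_exists u
    exact ⟨sqMk A b hb, rfl⟩
  · rw [injective_iff_map_eq_zero]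
    intro u hu
    obtain ⟨b, hb, rfl⟩ := sq_exists u
    rw [sqMap_mk, sqMk_zero_iff] at hu
    rwa [sqMk_zero_iff]

lemma sq_supp_sup {B X : Submodule R M} :
    Module.support R (subQuot R X (B ⊔ X)) ⊆ Module.support R (subQuot R ⊥ B) := by
  refine Module.support_subset_of_surjective
    (sqMap (bot_le : ⊥ ≤ X) (le_sup_left : B ≤ B ⊔ X)) ?_
  intro u
  obtain ⟨b, hb, rfl⟩ := sq_exists u
  obtain ⟨a, ha, z, hz, rfl⟩ := Submodule.mem_sup.1 hb
  refine ⟨sqMk _ a ha, ?_⟩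
  rw [sqMap_mk, sqMk_eq_iff, sub_add_cancel_left]
  exact Submodule.neg_mem _ hz

lemma sq_ass_mono {A B B' : Submodule R M} (hB : B ≤ B') :
    associatedPrimes R (subQuot R A B) ⊆ associatedPrimes R (subQuot R A B') :=
  associatedPrimes.subset_of_injective (f := sqMap (le_refl A) hB) (by
    rw [injective_iff_map_eq_zero]
    intro u hu
    obtain ⟨b, hb, rfl⟩ := sq_exists u
    rw [sqMap_mk, sqMk_zero_iff] at hu
    rwa [sqMk_zero_iff])

variable [IsNoetherianRing R] [Module.Finite R M]

instance sq_finite (A B : Submodule R M) : Module.Finite R (subQuot R A B) := inferInstance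

end SubQuots

section AbstractStep

set_option linter.unusedSectionVars false

variable {R : Type} [CommRing R] [IsNoetherianRing R]

lemma min_ass {N : Type} [AddCommGroup N] [Module R N] [Module.Finite R N] {q : PrimeSpectrum R}
    (hq : q ∈ Module.support R N) (hmin : ∀ q' ∈ Module.support R N, q' ≤ q → q' = q) :
    q.asIdeal ∈ associatedPrimes R N := by
  apply Module.associatedPrimes.minimalPrimes_annihilator_subset_associatedPrimes
  refine ⟨⟨q.2, Module.mem_support_iff_of_finite.1 hq⟩, ?_⟩
  rintro I ⟨hI, hI'⟩ hle
  have := hmin ⟨I, hI⟩ (Module.mem_support_iff_of_finite.2 hI') hle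
  rw [← this]

lemma killed_of_ass {N : Type} [AddCommGroup N] [Module R N] {m : PrimeSpectrum R}
    (h : m.asIdeal ∈ associatedPrimes R N) : ∃ w : N, w ≠ 0 ∧ ∀ r ∈ m.asIdeal, r • w = 0 := by
  obtain ⟨hp, w, hw⟩ := (isAssociatedPrime_iff).1 h
  refine ⟨w, ?_, ?_⟩
  · rintro rfl
    apply hp.ne_top
    rw [hw, Ideal.eq_top_iff_one]
    simp
  · intro r hr
    rw [hw] at hr
    simpa using hr

lemma smul_ne_of_killed {N : Type} [AddCommGroup N] [Module R N] {m : PrimeSpectrum R}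
    (hm : m.asIdeal.IsMaximal) {w : N} (hw : w ≠ 0) (hr : ∀ r ∈ m.asIdeal, r • w = 0) {r : R}
    (hrm : r ∉ m.asIdeal) : r • w ≠ 0 := by
  intro h
  obtain ⟨y, z, hz, hyz⟩ := hm.exists_inv hrm
  apply hw
  rw [← one_smul R w, ← hyz, add_smul, mul_smul, h, smul_zero, hr z hz, zero_add]

/-- All the data of the descending induction. -/
structure Dat (R : Type) [CommRing R] (n : ℕ) (m : PrimeSpectrum R) (M : Type) [AddCommGroup M]
    [Module R M] (x : R) (X : Submodule R M) (D Lp : ℕ → Submodule R M) (i : ℕ) : Prop where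
  hX : ∀ w, w ∈ X ↔ ∃ v, w = x • v
  xm : x ∈ m.asIdeal
  mono : ∀ c, D c ≤ D (c + 1)
  D0 : D 0 = ⊥
  Dtop : ∀ c, n ≤ c → D c = ⊤
  Lp0 : Lp 0 = X
  Ltop : Lp (n + 1) = ⊤
  Lmono : ∀ c, Lp c ≤ Lp (c + 1)
  DL : ∀ c, D c ⊔ X ≤ Lp c
  Ldim : ∀ c, ∀ p ∈ Module.support R (subQuot R X (Lp (c + 1))), ch p ≤ c
  Ddim : ∀ c, ∀ p ∈ Module.support R (subQuot R ⊥ (D c)), ch p ≤ c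
  Dass : ∀ c, ∀ p : PrimeSpectrum R, p.asIdeal ∈ associatedPrimes R (subQuot R (D c) ⊤) → c < ch p
  Qm : ∀ c, ∀ p : PrimeSpectrum R,
    p.asIdeal ∈ associatedPrimes R (subQuot R (D c ⊔ X) ⊤) → p ≤ m
  reg : ∀ c w, x • w ∈ D c → w ∈ D c
  gen : ∀ c a, ∀ q : PrimeSpectrum R,
    q.asIdeal ∈ associatedPrimes R (XX R (subQuot R (D c) (D (c + 1))) R a) → x ∈ q.asIdeal → q = m
  ext : i ≤ 2 → 1 ≤ n →
    ¬ ∃ w : XX R (subQuot R (⊥ : Submodule R M) ⊤) R (n - 1), w ≠ 0 ∧ ∀ r ∈ m.asIdeal, r • w = 0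
  C : ∀ c, i - 1 ≤ c → depthGE m (subQuot R (Lp c) (Lp (c + 1))) c

variable {n : ℕ} {m : PrimeSpectrum R} {M : Type} [AddCommGroup M] [Module R M] [Module.Finite R M]
  {x : R} {X : Submodule R M} {D Lp : ℕ → Submodule R M} {i : ℕ}

lemma Dat.lift_to_M (T : Dat R n m M x X D Lp i) (H : GH R n m) (hi : i ≤ 2) (hn : 1 ≤ n)
    (hd : depthGE m (subQuot R (D 2) ⊤) 3)
    (w : XX R (subQuot R (D 1) (D 2)) R (n - 1)) (hw : w ≠ 0)
    (hr : ∀ r ∈ m.asIdeal, r • w = 0) : False := by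
  -- step 1: move to D 2
  have s1 := sq_ses (bot_le : ⊥ ≤ D 1) (T.mono 1)
  have h1 : preX (sqMap (bot_le : ⊥ ≤ D 1) (le_refl (D 2))) R (n - 1) w ≠ 0 := by
    intro h0
    rcases Nat.lt_or_ge n 2 with h2 | h2
    · obtain rfl : n = 1 := by omega
      exact hw (preX0_inj s1.surj R (by rw [h0, map_zero]))
    · obtain ⟨a, rfl⟩ : ∃ a, n = a + 2 := ⟨n - 2, by omega⟩
      obtain ⟨δ, _, hδ⟩ := les_pre_delta s1 R a
      obtain ⟨v, hv⟩ := (hδ w).1 h0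
      have h3 : m ∉ SE R (subQuot R ⊥ (D 1)) a := by
        intro h4
        have := H.d (T.Ddim 1) h4
        omega
      rw [SE, Module.notMem_support_iff'] at h3
      obtain ⟨r, hrm, hrv⟩ := h3 v
      refine smul_ne_of_killed H.max hw hr hrm ?_
      rw [← hv, ← map_smul, hrv, map_zero]
  obtain ⟨w', hw', hr'⟩ : ∃ w' : XX R (subQuot R ⊥ (D 2)) R (n - 1), w' ≠ 0 ∧
      ∀ r ∈ m.asIdeal, r • w' = 0 :=
    ⟨_, h1, fun r hrm => by rw [← map_smul, hr r hrm, map_zero]⟩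
  -- step 2: move to M
  have s2 := sq_ses (bot_le : ⊥ ≤ D 2) (le_top : D 2 ≤ ⊤)
  obtain ⟨δ, hδ, _⟩ := les_pre_delta s2 R (n - 1)
  have h5 : m ∉ SE R (subQuot R (D 2) ⊤) (n - 1 + 1) := by
    intro h4
    have := H.g hd h4
    omega
  have h6 : m ∉ SE R (subQuot R (D 2) ⊤) (n - 1) := by
    intro h4
    have := H.g hd h4
    omega
  rw [SE, Module.notMem_support_iff'] at h5
  obtain ⟨r, hrm, hrv⟩ := h5 (δ w')
  rw [← map_smul] at hrv
  obtain ⟨y, hy⟩ := (hδ (r • w')).1 hrv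
  have h7 : ¬ Module.annihilator R (XX R (subQuot R (D 2) ⊤) R (n - 1)) ≤ m.asIdeal := by
    rwa [← Module.mem_support_iff_of_finite]
  obtain ⟨t, ht, htm⟩ := SetLike.not_le_iff_exists.1 h7
  have hex := les_pre s2 R (n - 1)
  refine T.ext hi hn ⟨t • y, ?_, ?_⟩
  · intro h0
    have h8 : t • (r • w') = 0 := by rw [← hy, ← map_smul, h0, map_zero]
    rw [smul_smul] at h8
    exact smul_ne_of_killed H.max hw' hr' (fun h9 => (m.2.mem_or_mem h9).elim htm hrm) h8
  · intro s hs
    have h9 : preX (sqMap (le_refl ⊥) (le_top : D 2 ≤ ⊤)) R (n - 1) (s • y) = 0 := by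
      rw [map_smul, hy, smul_comm, hr' s hs, smul_zero]
    obtain ⟨v, hv⟩ := (hex _).1 h9
    rw [smul_comm, ← hv, ← map_smul, Module.mem_annihilator.1 ht v, map_zero]

lemma Dat.U_zero (T : Dat R n m M x X D Lp i) (H : GH R n m) {c : ℕ} (hc : i - 1 ≤ c + 1)
    (hL : Lp (c + 2) = D (c + 2) ⊔ X)
    (hd : depthGE m (subQuot R (D (c + 2)) ⊤) (c + 3)) :
    Lp (c + 1) = D (c + 1) ⊔ X := by
  refine le_antisymm ?_ (T.DL _)
  rw [← sq_subsingleton_iff]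
  by_contra hU
  rw [not_subsingleton_iff_nontrivial] at hU
  have hUL : Lp (c + 1) ≤ D (c + 2) ⊔ X := hL ▸ T.Lmono (c + 1)
  have hmono : D (c + 1) ⊔ X ≤ D (c + 2) ⊔ X := sup_le_sup_right (T.mono _) X
  -- a prime of maximal coheight in the support
  obtain ⟨q, hq, hmax⟩ : ∃ q ∈ Module.support R (subQuot R (D (c + 1) ⊔ X) (Lp (c + 1))),
      ∀ p ∈ Module.support R (subQuot R (D (c + 1) ⊔ X) (Lp (c + 1))), ch p ≤ ch q := by
    have hne : ((ch (R := R)) '' Module.support R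
        (subQuot R (D (c + 1) ⊔ X) (Lp (c + 1)))).Nonempty :=
      (Module.nonempty_support_of_nontrivial).image _
    have hb : BddAbove ((ch (R := R)) '' Module.support R
        (subQuot R (D (c + 1) ⊔ X) (Lp (c + 1)))) := by
      refine ⟨n, ?_⟩
      rintro _ ⟨p, _, rfl⟩
      exact H.ch_le p
    obtain ⟨q, hq, hq'⟩ := Nat.sSup_mem hne hb
    refine ⟨q, hq, fun p hp => ?_⟩
    rw [hq']
    exact le_csSup hb ⟨p, hp, rfl⟩
  have he : ch q ≤ c := T.Ldim c q (sq_supp_mono le_sup_right le_rfl hq)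
  have hqass := min_ass hq (fun q' hq' hle => by
    by_contra hne
    have := H.ch_lt (lt_of_le_of_ne hle hne)
    have := hmax q' hq'
    omega)
  have hqm : q ≤ m := T.Qm (c + 1) q (sq_ass_mono le_top hqass)
  have hxq : x ∈ q.asIdeal := by
    apply Module.annihilator_le_of_mem_support hq
    rw [Module.mem_annihilator]
    intro u
    obtain ⟨b, hb, rfl⟩ := sq_exists u
    rw [smul_sqMk, sqMk_zero_iff]
    exact Submodule.mem_sup_right ((T.hX _).2 ⟨b, rfl⟩)
  obtain ⟨a, ha⟩ := H.G _ q hq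
  have hf := H.f ha
  have hdd := H.d hmax (Module.mem_support_mono hqm ha)
  have hC := T.C (c + 1) hc
  rw [hL] at hC
  have sUBC := sq_ses (T.DL (c + 1)) hUL
  have hB : q ∈ SE R (subQuot R (D (c + 1) ⊔ X) (D (c + 2) ⊔ X)) a := by
    rcases se_A sUBC ha with h | h
    · exact h
    · have := H.g hC (Module.mem_support_mono hqm h)
      omega
  have sP := sq_ses_smul T.hX (T.mono (c + 1)) (T.reg (c + 1)) (T.reg (c + 2))
  have hPass : ∀ p : PrimeSpectrum R,
      p.asIdeal ∈ associatedPrimes R (subQuot R (D (c + 1)) (D (c + 2))) → c + 2 ≤ ch p :=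
    fun p hp => T.Dass (c + 1) p (sq_ass_mono le_top hp)
  have hPa : q ∉ SE R (subQuot R (D (c + 1)) (D (c + 2))) a := by
    intro h
    have := H.fplus hPass h (by omega)
    omega
  obtain ⟨b, rfl⟩ : ∃ b, a = b + 1 := by
    rcases Nat.eq_zero_or_pos a with rfl | h
    · exact absurd (se_C0 sP.surj hB) hPa
    · exact ⟨a - 1, by omega⟩
  have hPb : q ∈ SE R (subQuot R (D (c + 1)) (D (c + 2))) b :=
    (se_C sP hB).resolve_right hPa
  have hPbass := min_ass hPb (fun q' hq' hle => by
    by_contra hne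
    have h1 := H.ch_lt (lt_of_le_of_ne hle hne)
    have h2 := H.f hq'
    have h3 := H.fplus hPass hq' (by omega)
    omega)
  obtain rfl : q = m := T.gen (c + 1) b q hPbass hxq
  rw [H.ch_m] at hf hdd
  obtain rfl : n = b + 1 := by omega
  obtain ⟨w, hw, hr⟩ := killed_of_ass hPbass
  -- lift to B
  have hBb : q ∈ SE R (subQuot R (D (c + 1) ⊔ X) (D (c + 2) ⊔ X)) b := by
    have hex := les_pre sP R b
    obtain ⟨z, hz⟩ := (hex w).1 (by rw [preX_smul_id]; exact hr x hxq)
    rw [SE, Module.mem_support_iff']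
    refine ⟨z, fun r hrq hrz => ?_⟩
    refine smul_ne_of_killed H.max hw hr hrq ?_
    rw [← hz, ← map_smul, hrz, map_zero]
  have hc0 : c = 0 := by
    rcases se_B sUBC hBb with h | h
    · have := H.g hC h
      omega
    · have := H.d (e := 0) (fun p hp => by rw [← H.ch_m]; exact hmax p hp) h
      omega
  subst hc0
  exact T.lift_to_M H (by omega) (by omega) hd w hw hr

lemma Dat.step (T : Dat R n m M x X D Lp i) (H : GH R n m) {c : ℕ} (hc : i - 1 ≤ c)
    (hL : Lp (c + 1) = D (c + 1) ⊔ X)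
    (hd : depthGE m (subQuot R (D (c + 1)) ⊤) (c + 2)) :
    Lp c = D c ⊔ X ∧ depthGE m (subQuot R (D c) (D (c + 1))) (c + 1) ∧
      depthGE m (subQuot R (D c) ⊤) (c + 1) := by
  have hU : Lp c = D c ⊔ X := by
    cases c with
    | zero => rw [T.D0, T.Lp0, bot_sup_eq]
    | succ c => exact T.U_zero H hc hL hd
  have hC := T.C c hc
  rw [hL, hU] at hC
  have hP := depthGE.lift T.xm (sq_ses_smul T.hX (T.mono c) (T.reg c) (T.reg (c + 1))) hC
  exact ⟨hU, hP, depthGE.mid (sq_ses (T.mono c) le_top) hP (hd.mono (by omega))⟩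

lemma Dat.main (T : Dat R n m M x X D Lp i) (H : GH R n m) (s : ℕ) : ∀ c, c + s = n + 1 →
    i - 1 ≤ c → Lp c = D c ⊔ X ∧ depthGE m (subQuot R (D c) ⊤) (c + 1) := by
  induction s with
  | zero =>
    intro c hc _
    obtain rfl : c = n + 1 := by omega
    rw [T.Ltop, T.Dtop (n + 1) (by omega), top_sup_eq]
    refine ⟨rfl, ?_⟩
    have : Subsingleton (subQuot R (⊤ : Submodule R M) ⊤) := sq_subsingleton_iff.2 le_rfl
    intro a _
    exact xx_subsingleton_right a
  | succ s ih =>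
    intro c hc hic
    obtain ⟨h1, h2⟩ := ih (c + 1) (by omega) (by omega)
    obtain ⟨h3, _, h4⟩ := T.step H hic h1 h2
    exact ⟨h3, h4⟩

lemma Dat.final (T : Dat R n m M x X D Lp i) (H : GH R n m) (c : ℕ) (hc : i - 1 ≤ c) :
    depthGE m (subQuot R (D c) (D (c + 1))) (c + 1) := by
  rcases Nat.lt_or_ge n c with h | h
  · have : Subsingleton (subQuot R (D c) (D (c + 1))) := by
      rw [sq_subsingleton_iff, T.Dtop c (by omega)]
      exact le_top
    intro a _
    exact xx_subsingleton_right a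
  · obtain ⟨h1, h2⟩ := T.main H (n - c) (c + 1) (by omega) (by omega)
    exact (T.step H hc h1 h2).2.1

end AbstractStep

section Graded

set_option linter.unusedSectionVars false

open MvPolynomial

variable {k : Type} [Field k] {n : ℕ} {M : Type} [AddCommGroup M]
  [Module (MvPolynomial (Fin n) k) M] [Module k M] [IsScalarTower k (MvPolynomial (Fin n) k) M]

/-- Abstract family of homogeneous component projections. -/
structure Cp (k : Type) [Field k] (n : ℕ) (M : Type) [AddCommGroup M]
    [Module (MvPolynomial (Fin n) k) M] [Module k M] [IsScalarTower k (MvPolynomial (Fin n) k) M]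
    (𝒜 : ℤ → Submodule k M) (cp : ℤ → M →ₗ[k] M) : Prop where
  mem : ∀ e w, cp e w ∈ 𝒜 e
  self : ∀ e, ∀ w ∈ 𝒜 e, cp e w = w
  other : ∀ e e', e ≠ e' → ∀ w ∈ 𝒜 e, cp e' w = 0
  sum : ∀ w, ∃ s : Finset ℤ, w = ∑ e ∈ s, cp e w ∧ ∀ e, e ∉ s → cp e w = 0
  smul : ∀ (d : ℕ) (f : MvPolynomial (Fin n) k), f.IsHomogeneous d → ∀ e w,
    cp e (f • w) = f • cp (e - d) w

lemma exists_cp (𝒜 : ℤ → Submodule k M) (hinternal : DirectSum.IsInternal 𝒜)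
    (hcompat : ∀ (e : ℕ) (f : MvPolynomial (Fin n) k), f.IsHomogeneous e →
      ∀ (d' : ℤ), ∀ x ∈ 𝒜 d', f • x ∈ 𝒜 (d' + (e : ℤ))) : ∃ cp, Cp k n M 𝒜 cp := by
  classical
  let _ := hinternal.chooseDecomposition
  let cp : ℤ → M →ₗ[k] M := fun e =>
    (𝒜 e).subtype ∘ₗ DirectSum.component k ℤ (fun i => 𝒜 i) e ∘ₗ
      (DirectSum.decomposeLinearEquiv 𝒜).toLinearMap
  have hcp : ∀ e w, cp e w = (DirectSum.decompose 𝒜 w e : M) := fun _ _ => rfl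
  have self : ∀ e, ∀ w ∈ 𝒜 e, cp e w = w := by
    intro e w hw
    rw [hcp]
    exact DirectSum.decompose_of_mem_same 𝒜 hw
  have other : ∀ e e', e ≠ e' → ∀ w ∈ 𝒜 e, cp e' w = 0 := by
    intro e e' hne w hw
    rw [hcp]
    exact DirectSum.decompose_of_mem_ne 𝒜 hw hne
  have mem : ∀ e w, cp e w ∈ 𝒜 e := fun e w => by rw [hcp]; exact SetLike.coe_mem _
  have sum : ∀ w, ∃ s : Finset ℤ, w = ∑ e ∈ s, cp e w ∧ ∀ e, e ∉ s → cp e w = 0 := by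
    intro w
    refine ⟨(DirectSum.decompose 𝒜 w).support, ?_, ?_⟩
    · exact (DirectSum.sum_support_decompose 𝒜 w).symm
    · intro e he
      rw [hcp]
      rw [DFinsupp.notMem_support_iff] at he
      rw [he]; rfl
  refine ⟨cp, mem, self, other, sum, ?_⟩
  intro d f hf e w
  obtain ⟨s, hs, hs0⟩ := sum w
  conv_lhs => rw [hs]
  rw [Finset.smul_sum, map_sum]
  rw [Finset.sum_eq_single (e - d)]
  · apply self
    have := hcompat d f hf (e - d) _ (mem (e - d) w)
    rwa [sub_add_cancel] at this
  · intro b _ hb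
    exact other (b + d) e (by omega) _ (hcompat d f hf b _ (mem b w))
  · intro h
    rw [hs0 _ h, smul_zero, map_zero]

variable {𝒜 : ℤ → Submodule k M} {cp : ℤ → M →ₗ[k] M}

lemma Cp.graded_iff (P : Cp k n M 𝒜 cp) (N : Submodule (MvPolynomial (Fin n) k) M) :
    IsGradedSub k n M 𝒜 N ↔ ∀ w ∈ N, ∀ e, cp e w ∈ N := by
  constructor
  · intro h w hw e
    have hw' := h (show w ∈ N.restrictScalars k from hw)
    induction hw' using Submodule.iSup_induction' with
    | mem e' z hz =>
      by_cases he : e' = e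
      · subst he
        rw [P.self _ _ hz.2]; exact hz.1
      · rw [P.other _ _ he _ hz.2]; exact N.zero_mem
    | zero => rw [map_zero]; exact N.zero_mem
    | add y z hy hz hy' hz' =>
      have hyz : ∀ z ∈ (⨆ e : ℤ, (N.restrictScalars k ⊓ 𝒜 e)), z ∈ N := by
        intro z hz
        have : (⨆ e : ℤ, (N.restrictScalars k ⊓ 𝒜 e)) ≤ N.restrictScalars k :=
          iSup_le fun e => inf_le_left
        exact this hz
      rw [map_add]
      exact N.add_mem (hy' (hyz _ hy)) (hz' (hyz _ hz))
  · intro h w hw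
    obtain ⟨s, hs, _⟩ := P.sum w
    rw [hs]
    refine Submodule.sum_mem _ fun e _ => ?_
    exact Submodule.mem_iSup_of_mem e ⟨h w hw e, P.mem e w⟩

lemma Cp.bdd (P : Cp k n M 𝒜 cp) (w : M) : ∃ E : ℤ, ∃ s : ℕ, (∀ e < E, cp e w = 0) ∧
    ∀ e, E + s ≤ e → cp e w = 0 := by
  obtain ⟨s, hs, h0⟩ := P.sum w
  obtain ⟨B, hB⟩ : ∃ B : ℕ, ∀ e ∈ s, e.natAbs ≤ B :=
    ⟨s.sup Int.natAbs, fun e he => Finset.le_sup (f := Int.natAbs) he⟩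
  refine ⟨-B, 2 * B + 1, fun e he => h0 e fun hes => ?_, fun e he => h0 e fun hes => ?_⟩
  · have := hB e hes
    omega
  · have := hB e hes
    push_cast at he
    omega

lemma Cp.smul_gen (P : Cp k n M 𝒜 cp) (f : MvPolynomial (Fin n) k) (e : ℤ) (w : M) :
    cp e (f • w) = ∑ d ∈ Finset.range (f.totalDegree + 1),
      homogeneousComponent d f • cp (e - d) w := by
  conv_lhs => rw [← sum_homogeneousComponent f]
  rw [Finset.sum_smul, map_sum]
  exact Finset.sum_congr rfl fun d _ => P.smul d _ (homogeneousComponent_isHomogeneous d f) e w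

lemma Cp.low (P : Cp k n M 𝒜 cp) {A : Submodule (MvPolynomial (Fin n) k) M}
    (hA : ∀ w ∈ A, ∀ e, cp e w ∈ A) (f : MvPolynomial (Fin n) k) (N : ℕ)
    (hf : ∀ d < N, homogeneousComponent d f = 0) (s : ℕ) : ∀ (E : ℤ) (u : M),
    (∀ e < E, cp e u ∈ A) → (∀ e, E + s ≤ e → cp e u ∈ A) → f • u ∈ A →
    (homogeneousComponent N f) ^ s • u ∈ A := by
  induction s with
  | zero =>
    intro E u h1 h2 _
    rw [pow_zero, one_smul]
    obtain ⟨t, ht, _⟩ := P.sum u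
    rw [ht]
    refine A.sum_mem fun e _ => ?_
    rcases lt_or_ge e E with h | h
    · exact h1 e h
    · exact h2 e (by simpa using h)
  | succ s ih =>
    intro E u h1 h2 h3
    set g := homogeneousComponent N f with hg
    have hgh : g.IsHomogeneous N := homogeneousComponent_isHomogeneous N f
    have h4 : g • cp E u ∈ A := by
      have h5 := hA _ h3 (E + N)
      rw [P.smul_gen] at h5
      by_cases hN : N ∈ Finset.range (f.totalDegree + 1)
      · rw [← Finset.add_sum_erase _ _ hN, add_sub_cancel_right] at h5
        have h6 : ∑ d ∈ (Finset.range (f.totalDegree + 1)).erase N,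
            homogeneousComponent d f • cp (E + N - d) u ∈ A := by
          refine A.sum_mem fun d hd => ?_
          rcases lt_or_gt_of_ne (Finset.ne_of_mem_erase hd) with h | h
          · rw [hf d h, zero_smul]; exact A.zero_mem
          · exact A.smul_mem _ (h1 _ (by omega))
        exact (A.add_mem_iff_left h6).1 h5
      · have : g = 0 := homogeneousComponent_eq_zero _ _ (by
          rw [Finset.mem_range] at hN; omega)
        rw [this, zero_smul]; exact A.zero_mem
    rw [pow_succ, mul_smul]
    refine ih (E + N + 1) (g • u) ?_ ?_ ?_
    · intro e he
      rw [P.smul N g hgh]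
      rcases eq_or_ne (e - N) E with h | h
      · rw [h]; exact h4
      · exact A.smul_mem _ (h1 _ (by omega))
    · intro e he
      rw [P.smul N g hgh]
      exact A.smul_mem _ (h2 _ (by push_cast; omega))
    · rw [smul_comm]
      exact A.smul_mem _ h3

lemma Cp.hom_comp (P : Cp k n M 𝒜 cp) {A : Submodule (MvPolynomial (Fin n) k) M}
    (hA : ∀ w ∈ A, ∀ e, cp e w ∈ A) {p : Ideal (MvPolynomial (Fin n) k)} (hp : p.IsPrime) {w : M}
    (hw : ∀ f, f ∈ p ↔ f • w ∈ A) (f : MvPolynomial (Fin n) k) (hf : f ∈ p) (N : ℕ) :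
    homogeneousComponent N f ∈ p := by
  induction N using Nat.strong_induction_on with
  | _ N ih =>
    set g := f - ∑ d ∈ Finset.range N, homogeneousComponent d f with hg
    have hgp : g ∈ p := p.sub_mem hf (p.sum_mem fun d hd => ih d (Finset.mem_range.1 hd))
    have hcomp : ∀ j, homogeneousComponent j g = if j < N then 0 else homogeneousComponent j f := by
      intro j
      rw [hg, map_sub, map_sum]
      have : ∀ d ∈ Finset.range N, homogeneousComponent j (homogeneousComponent d f) =
          if d = j then homogeneousComponent j f else 0 := by
        intro d _
        rw [homogeneousComponent_of_mem (homogeneousComponent_isHomogeneous d f)]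
        split_ifs with h1 h2 h2
        · rw [h1]
        · exact absurd h1.symm h2
        · exact absurd h2.symm h1
        · rfl
      rw [Finset.sum_congr rfl this, Finset.sum_ite_eq' (Finset.range N) j]
      simp only [Finset.mem_range]
      split_ifs <;> simp
    have hN : homogeneousComponent N g = homogeneousComponent N f := by
      rw [hcomp, if_neg (lt_irrefl N)]
    obtain ⟨E, s, h1, h2⟩ := P.bdd w
    have h3 := P.low hA g N (fun d hd => by rw [hcomp, if_pos hd]) s E w
      (fun e he => by rw [h1 e he]; exact A.zero_mem)
      (fun e he => by rw [h2 e he]; exact A.zero_mem) ((hw g).1 hgp)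
    rw [hN, ← hw] at h3
    exact hp.mem_of_pow_mem _ h3

lemma ass_sq {R : Type} [CommRing R] [IsNoetherianRing R] {M : Type} [AddCommGroup M] [Module R M]
    {A B : Submodule R M} {p : Ideal R}
    (hp : p ∈ associatedPrimes R (subQuot R A B)) : p.IsPrime ∧ ∃ w ∈ B, ∀ f, f ∈ p ↔ f • w ∈ A := by
  obtain ⟨h1, u, hu⟩ := (isAssociatedPrime_iff).1 hp
  refine ⟨h1, ?_⟩
  obtain ⟨w, hw, rfl⟩ := sq_exists u
  refine ⟨w, hw, fun f => ?_⟩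
  rw [hu, Submodule.mem_colon_singleton, smul_sqMk, Submodule.mem_bot, sqMk_zero_iff]

lemma Cp.le_m (P : Cp k n M 𝒜 cp) {A : Submodule (MvPolynomial (Fin n) k) M}
    (hA : ∀ w ∈ A, ∀ e, cp e w ∈ A) (p : PrimeSpectrum (MvPolynomial (Fin n) k))
    (hp : p.asIdeal ∈ associatedPrimes (MvPolynomial (Fin n) k)
      (subQuot (MvPolynomial (Fin n) k) A ⊤)) : p ≤ mP k n := by
  obtain ⟨h1, w, _, hw⟩ := ass_sq hp
  intro f hf
  change f ∈ irrIdeal k n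
  rw [mem_irrIdeal]
  have h2 := P.hom_comp hA h1 hw f hf 0
  rw [homogeneousComponent_zero] at h2
  by_contra hne
  exact h1.ne_top (Ideal.eq_top_of_isUnit_mem _ h2 ((isUnit_iff_ne_zero.2 hne).map C))

lemma Cp.hom_elt (P : Cp k n M 𝒜 cp) {A : Submodule (MvPolynomial (Fin n) k) M}
    (hA : ∀ w ∈ A, ∀ e, cp e w ∈ A) (p : Ideal (MvPolynomial (Fin n) k))
    (hp : p ∈ associatedPrimes (MvPolynomial (Fin n) k)
      (subQuot (MvPolynomial (Fin n) k) A ⊤)) :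
    ∃ e, ∃ w ∈ 𝒜 e, ∀ f, f ∈ p ↔ f • w ∈ A := by
  obtain ⟨h1, w, _, hw⟩ := ass_sq hp
  have h2 : ∀ e, ∀ f ∈ p, f • cp e w ∈ A := by
    intro e f hf
    rw [← sum_homogeneousComponent f, Finset.sum_smul]
    refine A.sum_mem fun d _ => ?_
    have h3 := (hw _).1 (P.hom_comp hA h1 hw f hf d)
    have h4 := hA _ h3 (e + d)
    rwa [P.smul d _ (homogeneousComponent_isHomogeneous d f), add_sub_cancel_right] at h4
  by_contra! hcon
  have h3 : ∀ e, ∃ g, g ∉ p ∧ g • cp e w ∈ A := by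
    intro e
    obtain ⟨f, hf⟩ := hcon e (cp e w) (P.mem e w)
    rcases hf with ⟨hf1, hf2⟩ | ⟨hf1, hf2⟩
    · exact absurd (h2 e f hf1) hf2
    · exact ⟨f, hf1, hf2⟩
  choose g hg hg' using h3
  obtain ⟨s, hs, _⟩ := P.sum w
  have h4 : ∏ e ∈ s, g e ∈ p := by
    rw [hw]
    have h5 : (∏ e ∈ s, g e) • w = (∏ e ∈ s, g e) • ∑ e ∈ s, cp e w := congrArg _ hs
    rw [h5, Finset.smul_sum]
    refine A.sum_mem fun e he => ?_
    rw [← Finset.prod_erase_mul _ _ he, mul_smul]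
    exact A.smul_mem _ (hg' e)
  obtain ⟨e, _, he⟩ := h1.prod_mem_iff.1 h4
  exact hg e he

end Graded

section DimLemmas

set_option linter.unusedSectionVars false

variable {R : Type} [CommRing R] [IsNoetherianRing R] {n : ℕ} {m : PrimeSpectrum R}

lemma mDim_le_iff (H : GH R n m) {N : Type} [AddCommGroup N] [Module R N] (c : ℕ) :
    mDim R N ≤ (c : WithBot ℕ∞) ↔ ∀ p ∈ Module.support R N, ch p ≤ c := by
  constructor
  · intro h p hp
    have h1 : Order.coheight p ≤ (c : ℕ∞) := by
      rw [Order.coheight_le_iff]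
      intro s hs
      have hmem : ∀ i, s i ∈ Module.support R N := fun i =>
        Module.mem_support_mono (hs.trans (s.head_le i)) hp
      let s' : LTSeries (Module.support R N) := ⟨s.length, fun i => ⟨s i, hmem i⟩, fun i => s.step i⟩
      have h2 : (s'.length : WithBot ℕ∞) ≤ (c : WithBot ℕ∞) := (Order.LTSeries.length_le_krullDim s').trans h
      exact_mod_cast h2
    rw [← H.coe_ch] at h1
    exact_mod_cast h1
  · intro h
    refine iSup_le fun s => ?_
    let s' : LTSeries (PrimeSpectrum R) := ⟨s.length, fun i => (s i).1, fun i => s.step i⟩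
    have h2 : (s'.length : ℕ∞) ≤ Order.coheight s'.head := Order.length_le_coheight_head
    rw [← H.coe_ch] at h2
    have h3 : s'.length ≤ ch s'.head := by exact_mod_cast h2
    have h4 := h s'.head s.head.2
    have h5 : s.length ≤ c := h3.trans h4
    exact_mod_cast h5

variable {M : Type} [AddCommGroup M] [Module R M]

lemma sq_notMem_supp {A B : Submodule R M} {p : PrimeSpectrum R} :
    p ∉ Module.support R (subQuot R A B) ↔ ∀ b ∈ B, ∃ r, r ∉ p.asIdeal ∧ r • b ∈ A := by
  rw [Module.notMem_support_iff']
  constructor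
  · intro h b hb
    obtain ⟨r, hr, h1⟩ := h (sqMk A b hb)
    rw [smul_sqMk, sqMk_zero_iff] at h1
    exact ⟨r, hr, h1⟩
  · intro h u
    obtain ⟨b, hb, rfl⟩ := sq_exists u
    obtain ⟨r, hr, h1⟩ := h b hb
    exact ⟨r, hr, by rw [smul_sqMk, sqMk_zero_iff]; exact h1⟩

/-- local closure of `A` at `p` -/
def locCl (A : Submodule R M) (p : PrimeSpectrum R) : Submodule R M where
  carrier := {b | ∃ r, r ∉ p.asIdeal ∧ r • b ∈ A}
  zero_mem' := ⟨1, fun h => p.2.ne_top ((Ideal.eq_top_iff_one _).2 h), by simp⟩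
  add_mem' := by
    rintro a b ⟨r, hr, ha⟩ ⟨s, hs, hb⟩
    refine ⟨r * s, fun h => (p.2.mem_or_mem h).elim hr hs, ?_⟩
    rw [smul_add]
    refine A.add_mem ?_ ?_
    · rw [mul_comm, mul_smul]; exact A.smul_mem _ ha
    · rw [mul_smul]; exact A.smul_mem _ hb
  smul_mem' := by
    rintro c a ⟨r, hr, ha⟩
    refine ⟨r, hr, ?_⟩
    rw [smul_comm]; exact A.smul_mem _ ha

lemma sq_notMem_supp' {A B : Submodule R M} {p : PrimeSpectrum R} :
    p ∉ Module.support R (subQuot R A B) ↔ B ≤ locCl A p := sq_notMem_supp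

/-- the trivial subquotient -/
noncomputable def sqTop : subQuot R (⊥ : Submodule R M) ⊤ ≃ₗ[R] M :=
  LinearEquiv.symm (LinearEquiv.ofBijective
    ((Submodule.mkQ _) ∘ₗ (Submodule.topEquiv (R := R) (M := M)).symm.toLinearMap)
    ⟨by
      rw [injective_iff_map_eq_zero]
      intro w hw
      exact (sqMk_zero_iff (A := (⊥ : Submodule R M)) (B := ⊤) (b := w) trivial).1 hw,
     (Submodule.mkQ_surjective _).comp (LinearEquiv.surjective _)⟩)

lemma reg_of_ass [Module.Finite R M] {A : Submodule R M} {x : R}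
    (h : ∀ p ∈ associatedPrimes R (subQuot R A ⊤), x ∉ p) (w : M) (hw : x • w ∈ A) : w ∈ A := by
  by_contra hcon
  have h1 : x ∈ ⋃ p ∈ associatedPrimes R (subQuot R A ⊤), (p : Set R) := by
    rw [biUnion_associatedPrimes_eq_zero_divisors]
    refine ⟨sqMk A w (Submodule.mem_top), ?_, ?_⟩
    · rw [Ne, sqMk_zero_iff]; exact hcon
    · rw [smul_sqMk, sqMk_zero_iff]; exact hw
  simp only [Set.mem_iUnion] at h1
  obtain ⟨p, hp, hx⟩ := h1
  exact h p hp hx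

lemma mem_span_smul_top (x : R) (w : M) :
    w ∈ (Ideal.span {x} • (⊤ : Submodule R M)) ↔ ∃ v, w = x • v := by
  rw [Submodule.ideal_span_singleton_smul, Submodule.mem_smul_pointwise_iff_exists]
  constructor
  · rintro ⟨v, _, rfl⟩; exact ⟨v, rfl⟩
  · rintro ⟨v, rfl⟩; exact ⟨v, Submodule.mem_top, rfl⟩

end DimLemmas

section DeltaLemmas

set_option linter.unusedSectionVars false

open MvPolynomial

variable {k : Type} [Field k] {n : ℕ} {M : Type} [AddCommGroup M]
  [Module (MvPolynomial (Fin n) k) M] [Module k M] [IsScalarTower k (MvPolynomial (Fin n) k) M]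
  {𝒜 : ℤ → Submodule k M} {cp : ℤ → M →ₗ[k] M}

/-- stability under taking components -/
def Gr (cp : ℤ → M →ₗ[k] M) (N : Submodule (MvPolynomial (Fin n) k) M) : Prop :=
  ∀ w ∈ N, ∀ e, cp e w ∈ N

lemma Gr.sup {A B : Submodule (MvPolynomial (Fin n) k) M} (hA : Gr cp A) (hB : Gr cp B) :
    Gr cp (A ⊔ B) := by
  intro w hw e
  obtain ⟨a, ha, b, hb, rfl⟩ := Submodule.mem_sup.1 hw
  rw [map_add]
  exact Submodule.add_mem_sup (hA a ha e) (hB b hb e)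

lemma gr_sSup {S : Set (Submodule (MvPolynomial (Fin n) k) M)} (hS : ∀ P ∈ S, Gr cp P) :
    Gr cp (sSup S) := by
  intro w hw
  rw [sSup_eq_iSup'] at hw
  refine Submodule.iSup_induction (motive := fun w => ∀ e, cp e w ∈ sSup S) _ hw ?_ ?_ ?_
  · intro P w hw e
    exact (le_sSup P.2 : P.1 ≤ sSup S) (hS P.1 P.2 w hw e)
  · intro e; rw [map_zero]; exact Submodule.zero_mem _
  · intro a b ha hb e; rw [map_add]; exact Submodule.add_mem _ (ha e) (hb e)

lemma Cp.gr_bot (_P : Cp k n M 𝒜 cp) : Gr cp (⊥ : Submodule (MvPolynomial (Fin n) k) M) := by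
  intro w hw e
  rw [Submodule.mem_bot] at hw ⊢
  rw [hw, map_zero]

lemma gr_top : Gr cp (⊤ : Submodule (MvPolynomial (Fin n) k) M) := fun _ _ _ => Submodule.mem_top

lemma linForm_hom (a : Fin n → k) : (linForm k n a).IsHomogeneous 1 := by
  refine IsHomogeneous.sum _ _ _ fun j _ => ?_
  have := (isHomogeneous_C (Fin n) (a j)).mul (isHomogeneous_X k j)
  simpa using this

lemma linForm_mem (a : Fin n → k) : linForm k n a ∈ irrIdeal k n := by
  refine Ideal.sum_mem _ fun j _ => Ideal.mul_mem_left _ _ (Ideal.subset_span ⟨j, rfl⟩)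

lemma Cp.gr_X (P : Cp k n M 𝒜 cp) (a : Fin n → k) :
    Gr cp (Ideal.span {linForm k n a} • (⊤ : Submodule (MvPolynomial (Fin n) k) M)) := by
  intro w hw e
  rw [mem_span_smul_top] at hw ⊢
  obtain ⟨v, rfl⟩ := hw
  exact ⟨_, P.smul 1 _ (linForm_hom a) e v⟩

lemma Cp.gr_span (P : Cp k n M 𝒜 cp) {e : ℤ} {w : M} (hw : w ∈ 𝒜 e) :
    Gr cp (Submodule.span (MvPolynomial (Fin n) k) {w}) := by
  intro v hv e'
  obtain ⟨f, rfl⟩ := Submodule.mem_span_singleton.1 hv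
  rw [← sum_homogeneousComponent f, Finset.sum_smul, map_sum]
  refine Submodule.sum_mem _ fun d _ => ?_
  rw [P.smul d _ (homogeneousComponent_isHomogeneous d f)]
  refine Submodule.smul_mem _ _ ?_
  by_cases h : e = e' - d
  · rw [← h, P.self e w hw]; exact Submodule.mem_span_singleton_self w
  · rw [P.other e _ h w hw]; exact Submodule.zero_mem _

/-- dimension bound of a subquotient in terms of `ch` -/
def dimLE (N P : Submodule (MvPolynomial (Fin n) k) M) (c : ℕ) : Prop :=
  ∀ p ∈ Module.support (MvPolynomial (Fin n) k) (subQuot (MvPolynomial (Fin n) k) N P), ch p ≤ c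

lemma Cp.delta_eq (P : Cp k n M 𝒜 cp) (N : Submodule (MvPolynomial (Fin n) k) M) (c : ℕ) :
    deltaPairG k n M 𝒜 N c = sSup {Q | N ≤ Q ∧ Gr cp Q ∧ dimLE N Q c} := by
  unfold deltaPairG
  congr 1
  ext Q
  simp only [Set.mem_ofPred_eq]
  rw [P.graded_iff, mDim_le_iff (gh_poly k n)]
  rfl

lemma Cp.delta_gr (P : Cp k n M 𝒜 cp) (N : Submodule (MvPolynomial (Fin n) k) M) (c : ℕ) :
    Gr cp (deltaPairG k n M 𝒜 N c) := by
  rw [P.delta_eq]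
  exact gr_sSup fun Q hQ => hQ.2.1

lemma Cp.le_delta (P : Cp k n M 𝒜 cp) {N Q : Submodule (MvPolynomial (Fin n) k) M} {c : ℕ}
    (h1 : N ≤ Q) (h2 : Gr cp Q) (h3 : dimLE N Q c) : Q ≤ deltaPairG k n M 𝒜 N c := by
  rw [P.delta_eq]
  exact le_sSup ⟨h1, h2, h3⟩

lemma Cp.delta_dim (P : Cp k n M 𝒜 cp) (N : Submodule (MvPolynomial (Fin n) k) M) (c : ℕ) :
    dimLE N (deltaPairG k n M 𝒜 N c) c := by
  intro p hp
  by_contra hcon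
  refine absurd hp (sq_notMem_supp'.2 ?_)
  rw [P.delta_eq]
  refine sSup_le fun Q hQ => ?_
  rw [← sq_notMem_supp']
  intro h
  exact hcon (hQ.2.2 p h)

lemma Cp.self_le_delta (P : Cp k n M 𝒜 cp) {N : Submodule (MvPolynomial (Fin n) k) M} (hN : Gr cp N)
    (c : ℕ) : N ≤ deltaPairG k n M 𝒜 N c := by
  refine P.le_delta le_rfl hN ?_
  have : Subsingleton (subQuot (MvPolynomial (Fin n) k) N N) := sq_subsingleton_iff.2 le_rfl
  intro p hp
  rw [Module.support_eq_empty] at hp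
  exact absurd hp (Set.notMem_empty _)

lemma Cp.delta_mono (P : Cp k n M 𝒜 cp) {N : Submodule (MvPolynomial (Fin n) k) M} (hN : Gr cp N)
    {c c' : ℕ} (h : c ≤ c') : deltaPairG k n M 𝒜 N c ≤ deltaPairG k n M 𝒜 N c' :=
  P.le_delta (P.self_le_delta hN c) (P.delta_gr N c) fun p hp => (P.delta_dim N c p hp).trans h

lemma Cp.delta_top (P : Cp k n M 𝒜 cp) {N : Submodule (MvPolynomial (Fin n) k) M}
    {c : ℕ} (h : n ≤ c) : deltaPairG k n M 𝒜 N c = ⊤ :=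
  top_le_iff.1 (P.le_delta le_top gr_top fun p _ => ((gh_poly k n).ch_le p).trans h)

variable [Module.Finite (MvPolynomial (Fin n) k) M]

lemma Cp.delta_ass (P : Cp k n M 𝒜 cp) (c : ℕ) (p : PrimeSpectrum (MvPolynomial (Fin n) k))
    (hp : p.asIdeal ∈ associatedPrimes (MvPolynomial (Fin n) k)
      (subQuot (MvPolynomial (Fin n) k) (deltaPairG k n M 𝒜 ⊥ c) ⊤)) : c < ch p := by
  by_contra! hcon
  obtain ⟨e, w, hw, hf⟩ := P.hom_elt (P.delta_gr ⊥ c) _ hp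
  set D := deltaPairG k n M 𝒜 (⊥ : Submodule (MvPolynomial (Fin n) k) M) c with hD
  have h1 : D ⊔ Submodule.span (MvPolynomial (Fin n) k) {w} ≤ D := by
    refine P.le_delta bot_le ((P.delta_gr ⊥ c).sup (P.gr_span hw)) ?_
    intro q hq
    by_contra hq1
    have hpq : ¬ p ≤ q := fun h => hq1 (((gh_poly k n).ch_anti h).trans hcon)
    have hD1 : D ≤ locCl ⊥ q := by
      rw [← sq_notMem_supp']
      exact fun h => hq1 (P.delta_dim ⊥ c q h)
    refine absurd hq (sq_notMem_supp'.2 (sup_le hD1 ?_))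
    rw [Submodule.span_singleton_le_iff_mem]
    obtain ⟨f, hfp, hfq⟩ := Set.not_subset.1 hpq
    obtain ⟨r, hr, hr2⟩ := hD1 ((hf f).1 hfp)
    refine ⟨r * f, fun h => (q.2.mem_or_mem h).elim hr hfq, ?_⟩
    rw [mul_smul]; exact hr2
  have h2 : w ∈ D := h1 (Submodule.mem_sup_right (Submodule.mem_span_singleton_self w))
  exact p.2.ne_top ((Ideal.eq_top_iff_one _).2 ((hf 1).2 (by rwa [one_smul])))

lemma eq_m_of_ch {k : Type} [Field k] {n : ℕ} {p : PrimeSpectrum (MvPolynomial (Fin n) k)}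
    (h : p ≤ mP k n) (h0 : ch p = 0) : p = mP k n := by
  rcases h.lt_or_eq with h1 | h1
  · have := (gh_poly k n).ch_lt h1
    omega
  · exact h1

lemma Cp.delta_zero (P : Cp k n M 𝒜 cp)
    (hM : ¬ ∃ w : subQuot (MvPolynomial (Fin n) k) (⊥ : Submodule (MvPolynomial (Fin n) k) M) ⊤,
      w ≠ 0 ∧ ∀ r ∈ (mP k n).asIdeal, r • w = 0) :
    deltaPairG k n M 𝒜 (⊥ : Submodule (MvPolynomial (Fin n) k) M) 0 = ⊥ := by
  by_contra hcon
  have h1 : ¬ Subsingleton (subQuot (MvPolynomial (Fin n) k) ⊥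
      (deltaPairG k n M 𝒜 (⊥ : Submodule (MvPolynomial (Fin n) k) M) 0)) := by
    rw [sq_subsingleton_iff]
    exact fun h => hcon (le_bot_iff.1 h)
  rw [not_subsingleton_iff_nontrivial] at h1
  obtain ⟨p, hp⟩ := associatedPrimes.nonempty (MvPolynomial (Fin n) k) (subQuot (MvPolynomial (Fin n) k) ⊥
      (deltaPairG k n M 𝒜 (⊥ : Submodule (MvPolynomial (Fin n) k) M) 0))
  have hp' := sq_ass_mono (le_top) hp
  let q : PrimeSpectrum (MvPolynomial (Fin n) k) := ⟨p, hp.1⟩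
  have h2 : q ≤ mP k n := P.le_m P.gr_bot q hp'
  have h3 : ch q ≤ 0 := by
    refine P.delta_dim ⊥ 0 q ?_
    rw [Module.mem_support_iff_of_finite]
    have h5 := IsAssociatedPrime.annihilator_le hp
    rwa [Submodule.annihilator_top] at h5
  have h4 := eq_m_of_ch h2 (by omega)
  apply hM
  apply killed_of_ass
  rw [← h4]
  exact hp'

end DeltaLemmas

section Generic

open MvPolynomial

variable {k : Type} [Field k] {n : ℕ}

lemma linForm_single (j : Fin n) : linForm k n (Pi.single j 1) = X j := by
  unfold linForm
  rw [Finset.sum_eq_single j]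
  · simp
  · intro b _ hb; simp [Pi.single_eq_of_ne hb]
  · simp

lemma generic_one (p : Ideal (MvPolynomial (Fin n) k)) (hp : p.IsPrime) (hne : p ≠ irrIdeal k n) :
    ∃ c : MvPolynomial (Fin n) k, c ≠ 0 ∧ ∀ a, linForm k n a ∈ p → eval a c = 0 := by
  let V : Submodule k (Fin n → k) :=
    { carrier := {a | linForm k n a ∈ p}
      zero_mem' := by simp [linForm]
      add_mem' := by
        intro a b ha hb
        have : linForm k n (a + b) = linForm k n a + linForm k n b := by
          simp [linForm, add_mul, Finset.sum_add_distrib]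
        simp only [Set.mem_ofPred_eq] at ha hb ⊢
        rw [this]; exact p.add_mem ha hb
      smul_mem' := by
        intro r a ha
        have : linForm k n (r • a) = C r * linForm k n a := by
          simp [linForm, Finset.mul_sum, mul_assoc]
        simp only [Set.mem_ofPred_eq] at ha ⊢
        rw [this]; exact p.mul_mem_left _ ha }
  have hV : V < ⊤ := by
    rw [lt_top_iff_ne_top]
    intro h
    apply hne
    have h1 : irrIdeal k n ≤ p := by
      refine Ideal.span_le.2 ?_
      rintro _ ⟨j, rfl⟩
      have h2 : (Pi.single j 1 : Fin n → k) ∈ V := by rw [h]; exact Submodule.mem_top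
      have h3 : linForm k n (Pi.single j 1) ∈ p := h2
      rwa [linForm_single] at h3
    exact ((irrIdeal_maximal k n).eq_of_le hp.ne_top h1).symm
  obtain ⟨f, hf, hVf⟩ := Submodule.exists_le_ker_of_lt_top V hV
  have hev : ∀ a, eval a (linForm k n fun j => f (Pi.single j 1)) = f a := by
    intro a
    rw [LinearMap.pi_apply_eq_sum_univ f a]
    simp only [linForm, map_sum, map_mul, eval_C, eval_X, smul_eq_mul]
    refine Finset.sum_congr rfl fun j _ => ?_
    rw [mul_comm]
    congr 2
    ext j'
    simp [Pi.single_apply, eq_comm]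
  refine ⟨_, ?_, fun a ha => (hev a).trans (hVf ha)⟩
  intro h0
  apply hf
  refine LinearMap.ext fun a => ?_
  rw [h0] at hev
  simpa using (hev a).symm

lemma generic_fin (S : Set (Ideal (MvPolynomial (Fin n) k))) (hS : S.Finite) :
    ∃ c : MvPolynomial (Fin n) k, c ≠ 0 ∧ ∀ a, eval a c ≠ 0 → ∀ p ∈ S, p.IsPrime →
      linForm k n a ∈ p → p = irrIdeal k n := by
  induction S, hS using Set.Finite.induction_on with
  | empty => exact ⟨1, one_ne_zero, fun a _ p hp => absurd hp (Set.notMem_empty _)⟩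
  | @insert q S hq _ ih =>
    obtain ⟨c, hc, h⟩ := ih
    by_cases hq1 : q.IsPrime ∧ q ≠ irrIdeal k n
    · obtain ⟨c', hc', h'⟩ := generic_one q hq1.1 hq1.2
      refine ⟨c * c', mul_ne_zero hc hc', ?_⟩
      intro a ha p hp hpp hx
      rw [map_mul] at ha
      rcases hp with rfl | hp
      · exact absurd (h' a hx) (right_ne_zero_of_mul ha)
      · exact h a (left_ne_zero_of_mul ha) p hp hpp hx
    · refine ⟨c, hc, ?_⟩
      intro a ha p hp hpp hx
      rcases hp with rfl | hp
      · by_contra hne; exact hq1 ⟨hpp, hne⟩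
      · exact h a ha p hp hpp hx

end Generic

section Main

set_option linter.unusedSectionVars false

open MvPolynomial

variable {k : Type} [Field k] {n : ℕ} {M : Type} [AddCommGroup M]
  [Module (MvPolynomial (Fin n) k) M] [Module k M] [IsScalarTower k (MvPolynomial (Fin n) k) M]
  {𝒜 : ℤ → Submodule k M} {cp : ℤ → M →ₗ[k] M} [Module.Finite (MvPolynomial (Fin n) k) M]

/-- the finite set of primes to avoid -/
def badSet (D : ℕ → Submodule (MvPolynomial (Fin n) k) M) : Set (Ideal (MvPolynomial (Fin n) k)) :=
  (⋃ c ∈ Set.Iic n, associatedPrimes (MvPolynomial (Fin n) k)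
      (subQuot (MvPolynomial (Fin n) k) (D c) ⊤)) ∪
  ⋃ c ∈ Set.Iic n, ⋃ a ∈ Set.Iic n, associatedPrimes (MvPolynomial (Fin n) k)
      (XX (MvPolynomial (Fin n) k) (subQuot (MvPolynomial (Fin n) k) (D c) (D (c + 1)))
        (MvPolynomial (Fin n) k) a)

lemma badSet_finite (D : ℕ → Submodule (MvPolynomial (Fin n) k) M) : (badSet D).Finite := by
  refine Set.Finite.union ?_ ?_
  · exact (Set.finite_Iic n).biUnion fun c _ => associatedPrimes.finite _ _
  · exact (Set.finite_Iic n).biUnion fun c _ => (Set.finite_Iic n).biUnion fun a _ =>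
      associatedPrimes.finite _ _

lemma isCM_depthGE {W : Type} [AddCommGroup W] [Module (MvPolynomial (Fin n) k) W] {c : ℕ}
    (h : IsCM (MvPolynomial (Fin n) k) (irrIdeal k n) W)
    (hc : ¬ (c ≠ 0 ∧ mDim (MvPolynomial (Fin n) k) W ≤ ((c - 1 : ℕ) : WithBot ℕ∞))) :
    depthGE (mP k n) W c := by
  apply depthGE_of_mDepth
  change _ ≤ mDepth _ (irrIdeal k n) _
  rcases Nat.eq_zero_or_pos c with rfl | hc0
  · simp
  · rw [← h.2] at hc
    by_contra hlt
    rw [not_le] at hlt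
    apply hc
    refine ⟨by omega, ?_⟩
    have h2 : mDepth (MvPolynomial (Fin n) k) (irrIdeal k n) W ≤ ((c - 1 : ℕ) : ℕ∞) := by
      apply Order.le_of_lt_add_one
      have h3 : ((c - 1 : ℕ) : ℕ∞) + 1 = (c : ℕ∞) := by
        have : c - 1 + 1 = c := by omega
        exact_mod_cast this
      rwa [h3]
    exact WithBot.coe_le_coe.2 h2

lemma Cp.mkDat (P : Cp k n M 𝒜 cp) (i : ℕ)
    (hdepth : 0 < mDepth (MvPolynomial (Fin n) k) (irrIdeal k n) M)
    (hExtdepth : ∀ ℓ : ℕ, i - 1 ≤ ℓ → ℓ ≤ n →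
      0 < mDepth (MvPolynomial (Fin n) k) (irrIdeal k n)
        (extC (MvPolynomial (Fin n) k) (n - ℓ) M (MvPolynomial (Fin n) k)))
    (a : Fin n → k)
    (ha : ∀ p ∈ badSet (fun c => deltaPairG k n M 𝒜 ⊥ c), p.IsPrime →
      linForm k n a ∈ p → p = irrIdeal k n)
    (hX : IsPartiallySCM k n M 𝒜
            (Ideal.span {linForm k n a} • (⊤ : Submodule (MvPolynomial (Fin n) k) M)) (i - 1)) :
    Dat (MvPolynomial (Fin n) k) n (mP k n) M (linForm k n a)
      (Ideal.span {linForm k n a} • (⊤ : Submodule (MvPolynomial (Fin n) k) M))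
      (fun c => deltaPairG k n M 𝒜 ⊥ c)
      (deltaPairGPred k n M 𝒜
        (Ideal.span {linForm k n a} • (⊤ : Submodule (MvPolynomial (Fin n) k) M))) i := by
  have H := gh_poly k n
  have hM0 : ¬ ∃ w : subQuot (MvPolynomial (Fin n) k) (⊥ : Submodule (MvPolynomial (Fin n) k) M) ⊤,
      w ≠ 0 ∧ ∀ r ∈ (mP k n).asIdeal, r • w = 0 := by
    apply not_ass_of_depthGE
    refine depthGE.congr (A := M) ?_ sqTop.symm
    apply depthGE_of_mDepth
    exact_mod_cast Order.one_le_iff_pos.2 hdepth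
  have hass : ∀ c, ∀ p ∈ associatedPrimes (MvPolynomial (Fin n) k)
      (subQuot (MvPolynomial (Fin n) k) (deltaPairG k n M 𝒜 ⊥ c) ⊤), linForm k n a ∉ p := by
    intro c p hp hx
    rcases Nat.lt_or_ge n c with h | h
    · obtain ⟨hp1, w, _, hw⟩ := ass_sq hp
      rw [P.delta_top h.le] at hw
      exact hp1.ne_top ((Ideal.eq_top_iff_one _).2 ((hw 1).2 Submodule.mem_top))
    · have h1 := ha p (Or.inl (Set.mem_biUnion (Set.mem_Iic.2 h) hp)) hp.1 hx
      have h2 := P.delta_ass c (mP k n) (by rw [h1] at hp; exact hp)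
      rw [H.ch_m] at h2
      omega
  have reg : ∀ c w, linForm k n a • w ∈ deltaPairG k n M 𝒜 ⊥ c → w ∈ deltaPairG k n M 𝒜 ⊥ c :=
    fun c w hw => reg_of_ass (hass c) w hw
  have D0 := P.delta_zero hM0
  have grX := P.gr_X a
  set X := (Ideal.span {linForm k n a} • (⊤ : Submodule (MvPolynomial (Fin n) k) M)) with hXdef
  have Lmono : ∀ c, deltaPairGPred k n M 𝒜 X c ≤ deltaPairGPred k n M 𝒜 X (c + 1) := by
    intro c
    cases c with
    | zero => exact P.self_le_delta grX 0
    | succ c => exact P.delta_mono grX (Nat.le_succ c)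
  have Ltop : deltaPairGPred k n M 𝒜 X (n + 1) = ⊤ := P.delta_top le_rfl
  refine
  { hX := mem_span_smul_top _
    xm := linForm_mem a
    mono := fun c => P.delta_mono P.gr_bot (Nat.le_succ c)
    D0 := D0
    Dtop := fun c hc => P.delta_top hc
    Lp0 := rfl
    Ltop := Ltop
    Lmono := Lmono
    DL := ?_
    Ldim := fun c => P.delta_dim X c
    Ddim := fun c => P.delta_dim ⊥ c
    Dass := fun c => P.delta_ass c
    Qm := fun c p hp => P.le_m ((P.delta_gr ⊥ c).sup grX) p hp
    reg := reg
    gen := ?_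
    ext := ?_
    C := ?_ }
  · intro c
    cases c with
    | zero =>
      change deltaPairG k n M 𝒜 ⊥ 0 ⊔ X ≤ X
      rw [D0]; simp
    | succ c =>
      change deltaPairG k n M 𝒜 ⊥ (c + 1) ⊔ X ≤ deltaPairG k n M 𝒜 X c
      refine P.le_delta le_sup_right ((P.delta_gr ⊥ _).sup grX) ?_
      intro p hp
      have h1 := sq_supp_sup hp
      have h2 := P.delta_dim ⊥ (c + 1) p h1
      by_contra hcon
      have hxp : linForm k n a ∈ p.asIdeal := by
        refine Module.annihilator_le_of_mem_support hp ?_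
        rw [Module.mem_annihilator]
        intro u
        obtain ⟨b, hb, rfl⟩ := sq_exists u
        rw [smul_sqMk, sqMk_zero_iff]
        exact (mem_span_smul_top _ _).2 ⟨b, rfl⟩
      have h3 := min_ass h1 (by
        intro q hq hqp
        by_contra hne
        have h4 := H.ch_lt (lt_of_le_of_ne hqp hne)
        have h5 := P.delta_dim ⊥ (c + 1) q hq
        omega)
      have h4 := sq_ass_mono (le_top) h3
      have h5 := hass 0 p.asIdeal (by rw [D0]; exact h4)
      exact h5 hxp
  · intro c b q hq hx
    have hq1 : Nontrivial (XX (MvPolynomial (Fin n) k) (subQuot (MvPolynomial (Fin n) k)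
        (deltaPairG k n M 𝒜 ⊥ c) (deltaPairG k n M 𝒜 ⊥ (c + 1))) (MvPolynomial (Fin n) k) b) := by
      by_contra hcon
      rw [not_nontrivial_iff_subsingleton] at hcon
      rw [associatedPrimes.eq_empty_of_subsingleton] at hq
      exact hq
    have hc : c ≤ n := by
      by_contra hcon
      have : Subsingleton (subQuot (MvPolynomial (Fin n) k)
        (deltaPairG k n M 𝒜 ⊥ c) (deltaPairG k n M 𝒜 ⊥ (c + 1))) := by
        rw [sq_subsingleton_iff, P.delta_top (c := c) (by omega)]
        exact le_top
      exact not_subsingleton_iff_nontrivial.2 hq1 (xx_subsingleton_left b)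
    have hb : b ≤ n := by
      by_contra hcon
      exact not_subsingleton_iff_nontrivial.2 hq1 (H.gl _ _ b (by omega))
    have h1 := ha q.asIdeal (Or.inr (Set.mem_biUnion (Set.mem_Iic.2 hc)
      (Set.mem_biUnion (Set.mem_Iic.2 hb) hq))) q.2 hx
    exact PrimeSpectrum.ext h1
  · intro hi2 hn
    apply not_ass_of_depthGE
    have h1 := hExtdepth 1 (by omega) hn
    have h2 : depthGE (mP k n)
        (extC (MvPolynomial (Fin n) k) (n - 1) M (MvPolynomial (Fin n) k)) 1 := by
      apply depthGE_of_mDepth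
      exact_mod_cast Order.one_le_iff_pos.2 h1
    exact (h2.congr (extCEquiv _ _ _)).congr (XXcongrLeft sqTop _ _)
  · intro c hc
    rcases hX c hc with h | h
    · intro b _
      exact xx_subsingleton_right (A := subQuot (MvPolynomial (Fin n) k)
        (deltaPairGPred k n M 𝒜 X c) (deltaPairG k n M 𝒜 X c)) b
    · by_cases hd : c ≠ 0 ∧ mDim (MvPolynomial (Fin n) k) (subQuot (MvPolynomial (Fin n) k)
        (deltaPairGPred k n M 𝒜 X c) (deltaPairG k n M 𝒜 X c)) ≤ ((c - 1 : ℕ) : WithBot ℕ∞)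
      · exfalso
        obtain ⟨hc0, hd⟩ := hd
        obtain ⟨c', rfl⟩ : ∃ c', c = c' + 1 := ⟨c - 1, by omega⟩
        rw [mDim_le_iff H] at hd
        have h3 : deltaPairG k n M 𝒜 X (c' + 1) ≤ deltaPairG k n M 𝒜 X c' := by
          refine P.le_delta (P.self_le_delta grX _) (P.delta_gr X _) ?_
          intro p hp
          by_contra hcon
          have h4 : p ∉ Module.support (MvPolynomial (Fin n) k) (subQuot (MvPolynomial (Fin n) k)
              X (deltaPairG k n M 𝒜 X c')) := fun h5 => hcon (P.delta_dim X c' p h5)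
          have h5 : p ∉ Module.support (MvPolynomial (Fin n) k) (subQuot (MvPolynomial (Fin n) k)
              (deltaPairG k n M 𝒜 X c') (deltaPairG k n M 𝒜 X (c' + 1))) := fun h6 => hcon (hd p h6)
          have h6 := Module.support_of_exact (sq_ses (P.self_le_delta grX c')
            (P.delta_mono grX (Nat.le_succ c'))).exact
            (sq_ses (P.self_le_delta grX c') (P.delta_mono grX (Nat.le_succ c'))).inj
            (sq_ses (P.self_le_delta grX c') (P.delta_mono grX (Nat.le_succ c'))).surj
          rw [h6] at hp
          exact hp.elim h4 h5
        exact not_subsingleton_iff_nontrivial.2 h.1 (sq_subsingleton_iff.2 h3)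
      · exact isCM_depthGE h hd

end Main

/-- Let `R = k[x_1, …, x_n]` (`k` infinite), `i ≥ 1`, and `M` a finitely
generated ℤ-graded `R`-module with `depth M > 0` and `depth Ext^{n-ℓ}_R(M, R) > 0` for all
`ℓ ≥ i - 1`.  Then, for a sufficiently general (linear) form `x`, if `M/xM` is
`(i-1)`-partially sequentially Cohen-Macaulay, then `M` is `i`-partially sequentially
Cohen-Macaulay. -/
theorem stmt17 (k : Type) [Field k] [Infinite k] (n : ℕ)
    (i : ℕ) (hi : 1 ≤ i)
    (M : Type) [AddCommGroup M] [Module (MvPolynomial (Fin n) k) M] [Module k M]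
    [IsScalarTower k (MvPolynomial (Fin n) k) M] [Module.Finite (MvPolynomial (Fin n) k) M]
    (𝒜 : ℤ → Submodule k M) (hinternal : DirectSum.IsInternal 𝒜)
    (hcompat : ∀ (e : ℕ) (f : MvPolynomial (Fin n) k), f.IsHomogeneous e →
      ∀ (d' : ℤ), ∀ x ∈ 𝒜 d', f • x ∈ 𝒜 (d' + (e : ℤ)))
    (hdepth : 0 < mDepth (MvPolynomial (Fin n) k) (irrIdeal k n) M)
    (hExtdepth : ∀ ℓ : ℕ, i - 1 ≤ ℓ → ℓ ≤ n →
      0 < mDepth (MvPolynomial (Fin n) k) (irrIdeal k n)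
        (extC (MvPolynomial (Fin n) k) (n - ℓ) M (MvPolynomial (Fin n) k))) :
    ∃ c : MvPolynomial (Fin n) k, c ≠ 0 ∧
      ∀ a : Fin n → k, MvPolynomial.eval a c ≠ 0 →
        (IsPartiallySCM k n M 𝒜
            (Ideal.span {linForm k n a} • (⊤ : Submodule (MvPolynomial (Fin n) k) M))
            (i - 1) →
          IsPartiallySCM k n M 𝒜 ⊥ i) := by
  obtain ⟨cp, P⟩ := exists_cp 𝒜 hinternal hcompat
  obtain ⟨g, hg, hgen⟩ := generic_fin _ (badSet_finite (fun c => deltaPairG k n M 𝒜 ⊥ c))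
  refine ⟨g, hg, fun a ha hX j hj => ?_⟩
  have T := P.mkDat i hdepth hExtdepth a (hgen a ha) hX
  have H := gh_poly k n
  obtain ⟨c, rfl⟩ : ∃ c, j = c + 1 := ⟨j - 1, by omega⟩
  change Subsingleton (subQuot (MvPolynomial (Fin n) k)
    (deltaPairG k n M 𝒜 ⊥ c) (deltaPairG k n M 𝒜 ⊥ (c + 1))) ∨
    IsCM (MvPolynomial (Fin n) k) (irrIdeal k n) (subQuot (MvPolynomial (Fin n) k)
    (deltaPairG k n M 𝒜 ⊥ c) (deltaPairG k n M 𝒜 ⊥ (c + 1)))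
  rcases subsingleton_or_nontrivial (subQuot (MvPolynomial (Fin n) k)
    (deltaPairG k n M 𝒜 ⊥ c) (deltaPairG k n M 𝒜 ⊥ (c + 1))) with hs | hs
  · exact Or.inl hs
  right
  refine ⟨hs, ?_⟩
  have hfin := T.final H c (by omega)
  have hmono := T.mono c
  have hdim : ∀ p ∈ Module.support (MvPolynomial (Fin n) k) (subQuot (MvPolynomial (Fin n) k)
      (deltaPairG k n M 𝒜 ⊥ c) (deltaPairG k n M 𝒜 ⊥ (c + 1))), ch p ≤ c + 1 := fun p hp =>
    T.Ddim (c + 1) p (sq_supp_mono bot_le le_rfl hp)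
  have hm : mP k n ∈ Module.support (MvPolynomial (Fin n) k) (subQuot (MvPolynomial (Fin n) k)
      (deltaPairG k n M 𝒜 ⊥ c) (deltaPairG k n M 𝒜 ⊥ (c + 1))) := by
    obtain ⟨p, hp⟩ := associatedPrimes.nonempty (MvPolynomial (Fin n) k)
      (subQuot (MvPolynomial (Fin n) k) (deltaPairG k n M 𝒜 ⊥ c) (deltaPairG k n M 𝒜 ⊥ (c + 1)))
    let q : PrimeSpectrum (MvPolynomial (Fin n) k) := ⟨p, hp.1⟩
    have h1 : q ≤ mP k n := P.le_m (P.delta_gr ⊥ c) q (sq_ass_mono le_top hp)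
    refine Module.mem_support_mono h1 ?_
    rw [Module.mem_support_iff_of_finite]
    have h5 := IsAssociatedPrime.annihilator_le hp
    rwa [Submodule.annihilator_top] at h5
  have hdep : mDepth (MvPolynomial (Fin n) k) (irrIdeal k n) (subQuot (MvPolynomial (Fin n) k)
      (deltaPairG k n M 𝒜 ⊥ c) (deltaPairG k n M 𝒜 ⊥ (c + 1))) = ((c + 1 : ℕ) : ℕ∞) := by
    refine le_antisymm ?_ (mDepth_of_depthGE (m := mP k n) hfin)
    by_contra hcon
    rw [not_le] at hcon
    refine H.depth_le_dim hdim hm (depthGE_of_mDepth ?_)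
    have := Order.add_one_le_of_lt hcon
    exact_mod_cast this
  rw [hdep]
  refine le_antisymm ?_ ((mDim_le_iff H (c + 1)).2 hdim)
  by_contra hcon
  rw [not_le] at hcon
  have h1 : mDim (MvPolynomial (Fin n) k) (subQuot (MvPolynomial (Fin n) k)
      (deltaPairG k n M 𝒜 ⊥ c) (deltaPairG k n M 𝒜 ⊥ (c + 1))) ≤ ((c : ℕ) : WithBot ℕ∞) := by
    revert hcon
    generalize mDim (MvPolynomial (Fin n) k) (subQuot (MvPolynomial (Fin n) k)
      (deltaPairG k n M 𝒜 ⊥ c) (deltaPairG k n M 𝒜 ⊥ (c + 1))) = y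
    intro hcon
    induction y using WithBot.recBotCoe with
    | bot => exact bot_le
    | coe y =>
      have h2 : y < ((c + 1 : ℕ) : ℕ∞) := by exact_mod_cast hcon
      have h3 : y ≤ (c : ℕ∞) := Order.le_of_lt_add_one (by exact_mod_cast h2)
      exact_mod_cast h3
  exact H.depth_le_dim ((mDim_le_iff H c).1 h1) hm hfin
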